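/- Denjoy's theorem for flows on the 2-torus: let X be a C² nonvanishing vector field on the 2-torus 𝕋² (the product of two circles, with its standard smooth manifold structure) that has no periodic orbit, i.e., no nonconstant integral curve γ of X satisfies γ(t+T) = γ(t) for all t for some T > 0. Then the closure of the image of every integral curve γ : ℝ → 𝕋² of X is all of 𝕋². -/

import Mathlib

open Manifold

section GlobalODE

open Set Metric
open scoped NNReal

variable {E : Type*} [NormedAddCommGroup E] [NormedSpace ℝ E]

theorem IsIntegralCurve.eq_of_lipschitz {v : ℝ → E → E} {K : ℝ≥0}
    (hv : ∀ t, LipschitzWith K (v t)) {f g : ℝ → E} (hf : IsIntegralCurve f v)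
    (hg : IsIntegralCurve g v) {t₀ : ℝ} (h : f t₀ = g t₀) : f = g :=
  ODE_solution_unique_univ (s := fun _ ↦ univ) (fun t ↦ (hv t).lipschitzOnWith)
    (fun t ↦ ⟨hf t, mem_univ _⟩) (fun t ↦ ⟨hg t, mem_univ _⟩) h

theorem IsIntegralCurve.dist_le_of_lipschitz {v : ℝ → E → E} {K : ℝ≥0}
    (hv : ∀ t, LipschitzWith K (v t)) {f g : ℝ → E} (hf : IsIntegralCurve f v)
    (hg : IsIntegralCurve g v) {t : ℝ} (ht : 0 ≤ t) :
    dist (f t) (g t) ≤ dist (f 0) (g 0) * Real.exp (K * t) := by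
  have := dist_le_of_trajectories_ODE (a := 0) (b := t) hv
    (hf.continuous.continuousOn) (fun s _ ↦ (hf s).hasDerivWithinAt)
    (hg.continuous.continuousOn) (fun s _ ↦ (hg s).hasDerivWithinAt) le_rfl t ⟨ht, le_rfl⟩
  simpa using this

/-- Gluing solutions on larger and larger intervals. -/
theorem exists_isIntegralCurve_of_forall_Icc {v : ℝ → E → E} {K : ℝ≥0}
    (hv : ∀ t, LipschitzWith K (v t)) (t₀ : ℝ) (x₀ : E)
    (h : ∀ n : ℕ, ∃ α : ℝ → E, α t₀ = x₀ ∧ ∀ t ∈ Icc (t₀ - (n + 1)) (t₀ + (n + 1)),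
      HasDerivWithinAt α (v t (α t)) (Icc (t₀ - (n + 1)) (t₀ + (n + 1))) t) :
    ∃ α : ℝ → E, α t₀ = x₀ ∧ IsIntegralCurve α v := by
  choose α hα₀ hα using h
  have key : ∀ n m : ℕ, n ≤ m → EqOn (α n) (α m) (Icc (t₀ - (n + 1)) (t₀ + (n + 1))) := by
    intro n m hnm
    have hnm' : (n : ℝ) ≤ m := by exact_mod_cast hnm
    have hn : (0 : ℝ) ≤ n := Nat.cast_nonneg n
    have hsub : Icc (t₀ - (n + 1)) (t₀ + (n + 1)) ⊆ Icc (t₀ - (m + 1)) (t₀ + (m + 1)) :=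
      Icc_subset_Icc (by linarith) (by linarith)
    refine ODE_solution_unique_of_mem_Icc (t₀ := t₀) (v := v) (s := fun _ ↦ univ) (K := K)
      (fun t _ ↦ (hv t).lipschitzOnWith) ⟨by linarith, by linarith⟩
      (fun t ht ↦ (hα n t ht).continuousWithinAt)
      (fun t ht ↦ (hα n t (Ioo_subset_Icc_self ht)).hasDerivAt (Icc_mem_nhds ht.1 ht.2))
      (fun _ _ ↦ mem_univ _)
      (fun t ht ↦ ((hα m t (hsub ht)).mono hsub).continuousWithinAt)
      (fun t ht ↦ ((hα m t (hsub (Ioo_subset_Icc_self ht))).mono hsub).hasDerivAt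
        (Icc_mem_nhds ht.1 ht.2))
      (fun _ _ ↦ mem_univ _) ((hα₀ n).trans (hα₀ m).symm)
  let N : ℝ → ℕ := fun t ↦ ⌈|t - t₀|⌉₊
  refine ⟨fun t ↦ α (N t) t, hα₀ _, fun t ↦ ?_⟩
  have hN : ∀ s : ℝ, |s - t₀| ≤ N s := fun s ↦ Nat.le_ceil _
  have hmem : ∀ s : ℝ, s ∈ Icc (t₀ - (N s + 1)) (t₀ + (N s + 1)) := fun s ↦ by
    have := abs_le.1 (hN s)
    constructor <;> linarith
  have hder : HasDerivAt (α (N t + 1)) (v t (α (N t + 1) t)) t := by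
    refine (hα (N t + 1) t ?_).hasDerivAt (Icc_mem_nhds ?_ ?_)
    · have := hmem t
      push_cast
      exact ⟨by linarith [this.1], by linarith [this.2]⟩
    · have := (hmem t).1
      push_cast
      linarith
    · have := (hmem t).2
      push_cast
      linarith
  have heq : ∀ s ∈ ball t 1, α (N s) s = α (N t + 1) s := by
    intro s hs
    refine key _ _ ?_ (hmem s)
    have h1 : |s - t₀| ≤ |t - t₀| + 1 := by
      have h2 : |s - t| < 1 := by simpa [Real.dist_eq] using hs
      calc |s - t₀| = |(s - t) + (t - t₀)| := by ring_nf
        _ ≤ |s - t| + |t - t₀| := abs_add_le _ _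
        _ ≤ _ := by linarith
    refine Nat.ceil_le.2 ?_
    push_cast
    linarith [hN t]
  have h3 := heq t (mem_ball_self one_pos)
  show HasDerivAt _ (v t (α (N t) t)) t
  rw [h3]
  exact hder.congr_of_eventuallyEq (Filter.eventually_of_mem (ball_mem_nhds t one_pos) heq)

/-- A bounded Lipschitz time-dependent vector field has global integral curves. -/
theorem exists_isIntegralCurve_of_lipschitz_of_bounded [CompleteSpace E]
    {v : ℝ → E → E} {K B : ℝ≥0}
    (hv : ∀ t, LipschitzWith K (v t)) (hc : ∀ x, Continuous (v · x)) (hB : ∀ t x, ‖v t x‖ ≤ B)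
    (t₀ : ℝ) (x₀ : E) : ∃ α : ℝ → E, α t₀ = x₀ ∧ IsIntegralCurve α v := by
  refine exists_isIntegralCurve_of_forall_Icc hv t₀ x₀ fun n ↦ ?_
  have hn : (0 : ℝ) ≤ n := Nat.cast_nonneg n
  have hp : IsPicardLindelof v (tmin := t₀ - (n + 1)) (tmax := t₀ + (n + 1))
      ⟨t₀, by linarith, by linarith⟩ x₀ (B * (n + 1)) 0 B K :=
    { lipschitzOnWith := fun t _ ↦ (hv t).lipschitzOnWith
      continuousOn := fun x _ ↦ (hc x).continuousOn
      norm_le := fun t _ x _ ↦ hB t x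
      mul_max_le := by simp }
  exact hp.exists_eq_forall_mem_Icc_hasDerivWithinAt₀

end GlobalODE

section NormalCoordinates

open Set Metric Complex
open scoped NNReal

/-- Uniform bounds satisfied by the lift to `ℂ` of a nonvanishing `C²` field on a torus. -/
structure IsTameField (F : ℂ → ℂ) (C : ℝ) : Prop where
  one_le : 1 ≤ C
  contDiff : ContDiff ℝ 2 F
  norm_le : ∀ z, ‖F z‖ ≤ C
  le_norm : ∀ z, 1 ≤ C * ‖F z‖
  lip : ∀ z w, ‖F z - F w‖ ≤ C * ‖z - w‖
  norm_fderiv_le : ∀ z, ‖fderiv ℝ F z‖ ≤ C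
  taylor : ∀ z u, ‖F (z + u) - F z - fderiv ℝ F z u‖ ≤ C * ‖u‖ ^ 2

/-- A choice of unit normal direction: `I` or `-I`. -/
def normalUnit (κ : ℝ) : ℂ := κ * I

/-- The point at signed distance `s ‖F x‖` from `x` along the normal to `F x`. -/
def normalPoint (F : ℂ → ℂ) (κ : ℝ) (x : ℂ) (s : ℝ) : ℂ := x + s * (normalUnit κ * F x)

/-- The field at a point of the normal through `x`, in the complex frame `F x`. -/
noncomputable def frameRatio (F : ℂ → ℂ) (κ : ℝ) (x : ℂ) (s : ℝ) : ℂ :=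
  F (normalPoint F κ x s) / F x

/-- The rotation rate of the frame along the orbit of `x`. -/
noncomputable def frameRate (F : ℂ → ℂ) (κ : ℝ) (x : ℂ) : ℂ :=
  normalUnit κ * fderiv ℝ F x (F x) / F x

/-- Time change between the orbit of `x` and the neighbouring orbit at normal coordinate `s`. -/
noncomputable def timeRate (F : ℂ → ℂ) (κ : ℝ) (x : ℂ) (s : ℝ) : ℝ :=
  (1 + s * (frameRate F κ x).re) / (frameRatio F κ x s).re

/-- Rate of change of the normal coordinate `s` of a neighbouring orbit. -/
noncomputable def normalRate (F : ℂ → ℂ) (κ : ℝ) (x : ℂ) (s : ℝ) : ℝ :=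
  κ * (timeRate F κ x s * (frameRatio F κ x s).im - s * (frameRate F κ x).im)

/-- Linear part of `normalRate` at `s = 0`. -/
noncomputable def normalRateLin (F : ℂ → ℂ) (κ : ℝ) (x : ℂ) : ℝ :=
  κ * ((fderiv ℝ F x (normalUnit κ * F x) / F x).im - (frameRate F κ x).im)

/-- Projection of `ℝ` to `[-ε, ε]`. -/
noncomputable def clamp (ε s : ℝ) : ℝ := max (-ε) (min s ε)

theorem clamp_of_abs_le {ε s : ℝ} (h : |s| ≤ ε) : clamp ε s = s := by
  have := abs_le.1 h
  simp [clamp, this.1, this.2]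

theorem abs_clamp_le {ε : ℝ} (hε : 0 ≤ ε) (s : ℝ) : |clamp ε s| ≤ ε := by
  rw [abs_le, clamp]
  exact ⟨le_max_left _ _, max_le (by linarith) (min_le_right _ _)⟩

theorem abs_clamp_sub_le (ε s t : ℝ) : |clamp ε s - clamp ε t| ≤ |s - t| := by
  refine (abs_max_sub_max_le_max _ _ _ _).trans ?_
  simp only [sub_self, abs_zero]
  refine max_le (abs_nonneg _) ((abs_min_sub_min_le_max _ _ _ _).trans ?_)
  simp

theorem continuous_clamp (ε : ℝ) : Continuous (clamp ε) := by
  unfold clamp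
  fun_prop

theorem norm_normalUnit {κ : ℝ} (hκ : |κ| = 1) : ‖normalUnit κ‖ = 1 := by
  simp [normalUnit, hκ]

variable {F : ℂ → ℂ} {C κ : ℝ}

namespace IsTameField

theorem pos (hF : IsTameField F C) : 0 < C := zero_lt_one.trans_le hF.one_le

theorem norm_pos (hF : IsTameField F C) (z : ℂ) : 0 < ‖F z‖ := by
  by_contra h
  have h1 := hF.le_norm z
  have h2 : ‖F z‖ = 0 := le_antisymm (not_lt.1 h) (norm_nonneg _)
  rw [h2, mul_zero] at h1
  linarith

theorem ne_zero (hF : IsTameField F C) (z : ℂ) : F z ≠ 0 := norm_pos_iff.1 (hF.norm_pos z)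

theorem norm_frameRatio_sub (hF : IsTameField F C) (hκ : |κ| = 1) (x : ℂ) (s t : ℝ) :
    ‖frameRatio F κ x s - frameRatio F κ x t‖ ≤ C * |s - t| := by
  have h0 := hF.norm_pos x
  rw [frameRatio, frameRatio, ← sub_div, norm_div, div_le_iff₀ h0]
  refine (hF.lip _ _).trans (le_of_eq ?_)
  have : normalPoint F κ x s - normalPoint F κ x t = (s - t : ℝ) * (normalUnit κ * F x) := by
    simp only [normalPoint]
    push_cast
    ring
  rw [this, norm_mul, norm_mul, norm_normalUnit hκ, Complex.norm_real, Real.norm_eq_abs]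
  ring

theorem frameRatio_zero (hF : IsTameField F C) (κ : ℝ) (x : ℂ) : frameRatio F κ x 0 = 1 := by
  simp [frameRatio, normalPoint, div_self (hF.ne_zero x)]

theorem norm_frameRatio_sub_one (hF : IsTameField F C) (hκ : |κ| = 1) (x : ℂ) (s : ℝ) :
    ‖frameRatio F κ x s - 1‖ ≤ C * |s| := by
  simpa [hF.frameRatio_zero] using hF.norm_frameRatio_sub hκ x s 0

theorem norm_frameRate_le (hF : IsTameField F C) (hκ : |κ| = 1) (x : ℂ) :
    ‖frameRate F κ x‖ ≤ C := by
  rw [frameRate, norm_div, norm_mul, norm_normalUnit hκ, one_mul, div_le_iff₀ (hF.norm_pos x)]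
  exact ((fderiv ℝ F x).le_opNorm _).trans
    (mul_le_mul_of_nonneg_right (hF.norm_fderiv_le x) (norm_nonneg _))

theorem abs_re_frameRate_le (hF : IsTameField F C) (hκ : |κ| = 1) (x : ℂ) :
    |(frameRate F κ x).re| ≤ C := (abs_re_le_norm _).trans (hF.norm_frameRate_le hκ x)

theorem abs_im_frameRate_le (hF : IsTameField F C) (hκ : |κ| = 1) (x : ℂ) :
    |(frameRate F κ x).im| ≤ C := (abs_im_le_norm _).trans (hF.norm_frameRate_le hκ x)

theorem abs_re_frameRatio_sub_one (hF : IsTameField F C) (hκ : |κ| = 1) (x : ℂ) (s : ℝ) :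
    |(frameRatio F κ x s).re - 1| ≤ C * |s| := by
  simpa using (abs_re_le_norm _).trans (hF.norm_frameRatio_sub_one hκ x s)

theorem abs_im_frameRatio (hF : IsTameField F C) (hκ : |κ| = 1) (x : ℂ) (s : ℝ) :
    |(frameRatio F κ x s).im| ≤ C * |s| := by
  simpa using (abs_im_le_norm _).trans (hF.norm_frameRatio_sub_one hκ x s)

theorem re_frameRatio_bounds (hF : IsTameField F C) (hκ : |κ| = 1) (x : ℂ) {s : ℝ}
    (hs : C * |s| ≤ 1 / 16) :
    15 / 16 ≤ (frameRatio F κ x s).re ∧ (frameRatio F κ x s).re ≤ 17 / 16 := by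
  have := abs_le.1 ((hF.abs_re_frameRatio_sub_one hκ x s).trans hs)
  constructor <;> linarith [this.1, this.2]

theorem abs_mul_re_frameRate (hF : IsTameField F C) (hκ : |κ| = 1) (x : ℂ) (s : ℝ) :
    |s * (frameRate F κ x).re| ≤ C * |s| := by
  rw [abs_mul, mul_comm]
  exact mul_le_mul_of_nonneg_right (hF.abs_re_frameRate_le hκ x) (abs_nonneg _)

theorem timeRate_bounds (hF : IsTameField F C) (hκ : |κ| = 1) (x : ℂ) {s : ℝ}
    (hs : C * |s| ≤ 1 / 16) : 1 / 2 ≤ timeRate F κ x s ∧ timeRate F κ x s ≤ 2 := by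
  have h1 := hF.re_frameRatio_bounds hκ x hs
  have h2 := abs_le.1 ((hF.abs_mul_re_frameRate hκ x s).trans hs)
  have h3 : 0 < (frameRatio F κ x s).re := by linarith [h1.1]
  rw [timeRate, le_div_iff₀ h3, div_le_iff₀ h3]
  constructor <;> linarith [h1.1, h1.2, h2.1, h2.2]

theorem abs_timeRate_sub_one (hF : IsTameField F C) (hκ : |κ| = 1) (x : ℂ) {s : ℝ}
    (hs : C * |s| ≤ 1 / 16) : |timeRate F κ x s - 1| ≤ 3 * C * |s| := by
  have h1 := hF.re_frameRatio_bounds hκ x hs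
  have h3 : 0 < (frameRatio F κ x s).re := by linarith [h1.1]
  have h4 := abs_le.1 (hF.abs_mul_re_frameRate hκ x s)
  have h5 := abs_le.1 (hF.abs_re_frameRatio_sub_one hκ x s)
  have h6 : timeRate F κ x s - 1 = (s * (frameRate F κ x).re - ((frameRatio F κ x s).re - 1)) /
      (frameRatio F κ x s).re := by
    rw [timeRate]
    field_simp
    ring
  have h7 : 0 ≤ C * |s| := mul_nonneg hF.pos.le (abs_nonneg _)
  rw [h6, abs_div, abs_of_pos h3, div_le_iff₀ h3, abs_le]
  constructor <;> nlinarith [h1.1, h1.2, h4.1, h4.2, h5.1, h5.2]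

theorem abs_normalRate_sub (hF : IsTameField F C) (hκ : |κ| = 1) (x : ℂ) {s t : ℝ}
    (hs : C * |s| ≤ 1 / 16) (ht : C * |t| ≤ 1 / 16) :
    |normalRate F κ x s - normalRate F κ x t| ≤ 4 * C * |s - t| := by
  have as := hF.re_frameRatio_bounds hκ x hs
  have at' := hF.re_frameRatio_bounds hκ x ht
  have bs := (hF.abs_im_frameRatio hκ x s).trans hs
  have bt := (hF.abs_im_frameRatio hκ x t).trans ht
  have da : |(frameRatio F κ x s).re - (frameRatio F κ x t).re| ≤ C * |s - t| := by
    simpa using (abs_re_le_norm _).trans (hF.norm_frameRatio_sub hκ x s t)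
  have db : |(frameRatio F κ x s).im - (frameRatio F κ x t).im| ≤ C * |s - t| := by
    simpa using (abs_im_le_norm _).trans (hF.norm_frameRatio_sub hκ x s t)
  have hs' := (hF.abs_mul_re_frameRate hκ x s).trans hs
  have hH := hF.abs_re_frameRate_le hκ x
  have hI := hF.abs_im_frameRate_le hκ x
  simp only [normalRate, timeRate]
  rw [← mul_sub, abs_mul, hκ, one_mul]
  generalize (frameRatio F κ x s).re = a at *
  generalize (frameRatio F κ x t).re = a' at *
  generalize (frameRatio F κ x s).im = b at *
  generalize (frameRatio F κ x t).im = b' at *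
  generalize (frameRate F κ x).re = H at *
  generalize (frameRate F κ x).im = J at *
  have hC := hF.pos
  have ha : 0 < a := by linarith [as.1]
  have ha' : 0 < a' := by linarith [at'.1]
  have hd : 0 ≤ C * |s - t| := mul_nonneg hC.le (abs_nonneg _)
  have hr' : |b' / a'| ≤ 1 / 15 := by
    rw [abs_div, abs_of_pos ha', div_le_iff₀ ha']
    linarith [at'.1]
  have hrr : |b / a - b' / a'| ≤ 2 * (C * |s - t|) := by
    have e : b / a - b' / a' = ((b - b') * a' - b' * (a - a')) / (a * a') := by
      field_simp
      ring
    rw [e, abs_div, abs_of_pos (mul_pos ha ha'), div_le_iff₀ (mul_pos ha ha')]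
    have n1 : |(b - b') * a' - b' * (a - a')| ≤ C * |s - t| * (17 / 16) + 1 / 16 * (C * |s - t|) := by
      refine (abs_sub _ _).trans ?_
      rw [abs_mul, abs_mul, abs_of_pos ha']
      exact add_le_add (mul_le_mul db at'.2 ha'.le hd) (mul_le_mul bt da (abs_nonneg _) (by norm_num))
    have n2 : 225 / 256 ≤ a * a' := by nlinarith [as.1, at'.1]
    nlinarith
  have e : (1 + s * H) / a * b - s * J - ((1 + t * H) / a' * b' - t * J) =
      (1 + s * H) * (b / a - b' / a') + (s - t) * H * (b' / a') - (s - t) * J := by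
    field_simp
    ring
  rw [e]
  have n3 : |(1 + s * H) * (b / a - b' / a')| ≤ 17 / 16 * (2 * (C * |s - t|)) := by
    rw [abs_mul]
    refine mul_le_mul ?_ hrr (abs_nonneg _) (by norm_num)
    have := abs_le.1 hs'
    rw [abs_le]
    constructor <;> linarith [this.1, this.2]
  have n4 : |(s - t) * H * (b' / a')| ≤ (C * |s - t|) * (1 / 15) := by
    rw [abs_mul, abs_mul, mul_comm |s - t|]
    exact mul_le_mul (mul_le_mul_of_nonneg_right hH (abs_nonneg _)) hr' (abs_nonneg _) hd
  have n5 : |(s - t) * J| ≤ C * |s - t| := by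
    rw [abs_mul, mul_comm]
    exact mul_le_mul_of_nonneg_right hI (abs_nonneg _)
  have := abs_sub ((1 + s * H) * (b / a - b' / a') + (s - t) * H * (b' / a')) ((s - t) * J)
  have := abs_add_le ((1 + s * H) * (b / a - b' / a')) ((s - t) * H * (b' / a'))
  linarith

theorem normalRate_zero (hF : IsTameField F C) (κ : ℝ) (x : ℂ) : normalRate F κ x 0 = 0 := by
  simp [normalRate, hF.frameRatio_zero]

/-- Second order Taylor estimate for the normal rate. -/
theorem abs_normalRate_sub_lin (hF : IsTameField F C) (hκ : |κ| = 1) (x : ℂ) {s : ℝ}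
    (hs : C * |s| ≤ 1 / 16) :
    |normalRate F κ x s - normalRateLin F κ x * s| ≤ 4 * C ^ 2 * s ^ 2 := by
  have hC := hF.pos
  set b := fderiv ℝ F x (normalUnit κ * F x) / F x with hb
  have h1 : ‖frameRatio F κ x s - 1 - s * b‖ ≤ C ^ 2 * s ^ 2 := by
    have e : frameRatio F κ x s - 1 - s * b = (F (x + s * (normalUnit κ * F x)) - F x -
        fderiv ℝ F x (s * (normalUnit κ * F x))) / F x := by
      have : ((s : ℂ) * (normalUnit κ * F x)) = s • (normalUnit κ * F x) := by simp
      rw [this, map_smul, frameRatio, normalPoint, hb, Complex.real_smul, Complex.real_smul]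
      have := hF.ne_zero x
      field_simp
    rw [e, norm_div, div_le_iff₀ (hF.norm_pos x)]
    refine (hF.taylor _ _).trans ?_
    rw [norm_mul, norm_mul, norm_normalUnit hκ, Complex.norm_real, Real.norm_eq_abs, one_mul,
      mul_pow, sq_abs]
    have := hF.norm_le x
    have := hF.norm_pos x
    have : C * s ^ 2 * ‖F x‖ * ‖F x‖ ≤ C * s ^ 2 * ‖F x‖ * C := by gcongr
    nlinarith
  have h2 : |(frameRatio F κ x s).im - s * b.im| ≤ C ^ 2 * s ^ 2 := by
    simpa using (abs_im_le_norm _).trans h1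
  have h3 := hF.abs_timeRate_sub_one hκ x hs
  have h4 := hF.abs_im_frameRatio hκ x s
  have e : normalRate F κ x s - normalRateLin F κ x * s =
      κ * ((timeRate F κ x s - 1) * (frameRatio F κ x s).im +
        ((frameRatio F κ x s).im - s * b.im)) := by
    simp only [normalRate, normalRateLin, ← hb]
    ring
  rw [e, abs_mul, hκ, one_mul]
  refine (abs_add_le _ _).trans ?_
  have h5 : |(timeRate F κ x s - 1) * (frameRatio F κ x s).im| ≤ 3 * C * |s| * (C * |s|) := by
    rw [abs_mul]
    exact mul_le_mul h3 h4 (abs_nonneg _) (by positivity)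
  have h6 : 3 * C * |s| * (C * |s|) = 3 * C ^ 2 * s ^ 2 := by
    rw [← sq_abs s]
    ring
  linarith

/-- The algebraic identity defining `timeRate` and `normalRate`. -/
theorem timeRate_mul (hF : IsTameField F C) (hκ : |κ| = 1) (x : ℂ) {s : ℝ}
    (hs : C * |s| ≤ 1 / 16) :
    F x + s * (normalUnit κ * fderiv ℝ F x (F x)) + normalRate F κ x s * (normalUnit κ * F x) =
      timeRate F κ x s * F (normalPoint F κ x s) := by
  have h0 := hF.ne_zero x
  have h1 : (frameRatio F κ x s).re ≠ 0 := by linarith [(hF.re_frameRatio_bounds hκ x hs).1]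
  have key : 1 + s * frameRate F κ x + normalRate F κ x s * normalUnit κ =
      timeRate F κ x s * frameRatio F κ x s := by
    have hκ2 : κ * κ = 1 := by rw [← abs_mul_abs_self, hκ, one_mul]
    apply Complex.ext
    · simp [normalUnit, timeRate]
      field_simp
    · simp [normalUnit, normalRate]
      linear_combination (timeRate F κ x s * (frameRatio F κ x s).im -
        s * (frameRate F κ x).im) * hκ2
  have e1 : frameRatio F κ x s * F x = F (normalPoint F κ x s) := by
    rw [frameRatio, div_mul_cancel₀ _ h0]
  have e2 : frameRate F κ x * F x = normalUnit κ * fderiv ℝ F x (F x) := by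
    rw [frameRate, div_mul_cancel₀ _ h0]
  rw [← e1, ← e2]
  linear_combination F x * key

end IsTameField

end NormalCoordinates

section FlowSections

open Set Metric Complex
open scoped NNReal

/-- `φ z` is the integral curve of `F` starting at `z`. -/
structure IsFlowOf (F : ℂ → ℂ) (φ : ℂ → ℝ → ℂ) : Prop where
  zero : ∀ z, φ z 0 = z
  isIntegralCurve : ∀ z, IsIntegralCurve (φ z) (fun _ ↦ F)

/-- The half-open normal segment of length `s` at `x` misses `M`. -/
def IsGap (F : ℂ → ℂ) (κ : ℝ) (M : Set ℂ) (x : ℂ) (s : ℝ) : Prop :=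
  ∀ r, 0 < r → r ≤ s → normalPoint F κ x r ∉ M

theorem IsGap.mono {F : ℂ → ℂ} {κ : ℝ} {M : Set ℂ} {x : ℂ} {s t : ℝ} (h : IsGap F κ M x s)
    (hts : t ≤ s) : IsGap F κ M x t := fun r h0 h1 ↦ h r h0 (h1.trans hts)

/-- The width of the normal strips on which all estimates hold. -/
noncomputable def stripWidth (C : ℝ) : ℝ := 1 / (16 * C ^ 5)

variable {F : ℂ → ℂ} {C κ : ℝ} {φ : ℂ → ℝ → ℂ}

theorem IsTameField.lipschitzWith (hF : IsTameField F C) : LipschitzWith C.toNNReal F :=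
  LipschitzWith.of_dist_le_mul fun z w ↦ by
    rw [dist_eq_norm, dist_eq_norm, Real.coe_toNNReal _ hF.pos.le]
    exact hF.lip z w

theorem IsTameField.exists_isFlowOf (hF : IsTameField F C) : ∃ φ, IsFlowOf F φ := by
  have h : ∀ z, ∃ α : ℝ → ℂ, α 0 = z ∧ IsIntegralCurve α (fun _ ↦ F) := fun z ↦
    exists_isIntegralCurve_of_lipschitz_of_bounded (B := C.toNNReal) (fun _ ↦ hF.lipschitzWith)
      (fun _ ↦ continuous_const)
      (fun _ x ↦ by rw [Real.coe_toNNReal _ hF.pos.le]; exact hF.norm_le x) 0 z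
  choose φ h0 h1 using h
  exact ⟨φ, h0, h1⟩

theorem IsTameField.lipschitzWith_neg (hF : IsTameField F C) : LipschitzWith C.toNNReal (fun z ↦ -F z) :=
  hF.lipschitzWith.neg

theorem stripWidth_pos (hC : 1 ≤ C) : 0 < stripWidth C := by
  unfold stripWidth
  positivity

theorem mul_stripWidth_le (hC : 1 ≤ C) : C * stripWidth C ≤ 1 / 16 := by
  have h4 : 1 ≤ C ^ 4 := one_le_pow₀ hC
  have : C * stripWidth C = 1 / 16 / C ^ 4 := by
    unfold stripWidth
    field_simp
  rw [this]
  exact div_le_self (by norm_num) h4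

theorem IsTameField.mul_abs_le (hF : IsTameField F C) {s : ℝ} (hs : |s| ≤ stripWidth C) :
    C * |s| ≤ 1 / 16 :=
  (mul_le_mul_of_nonneg_left hs hF.pos.le).trans (mul_stripWidth_le hF.one_le)

namespace IsFlowOf

theorem eq_of_isIntegralCurve (hφ : IsFlowOf F φ) (hF : IsTameField F C) {γ : ℝ → ℂ}
    (hγ : IsIntegralCurve γ (fun _ ↦ F)) : φ (γ 0) = γ :=
  (hφ.isIntegralCurve _).eq_of_lipschitz (fun _ ↦ hF.lipschitzWith) hγ (t₀ := 0) (hφ.zero _)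

theorem add (hφ : IsFlowOf F φ) (hF : IsTameField F C) (z : ℂ) (s t : ℝ) :
    φ z (s + t) = φ (φ z s) t := by
  have h := hφ.eq_of_isIntegralCurve hF (γ := fun t ↦ φ z (s + t))
    (fun t ↦ (hφ.isIntegralCurve z (s + t)).comp_const_add s t)
  simp only [add_zero] at h
  rw [h]

theorem continuous (hφ : IsFlowOf F φ) (z : ℂ) : Continuous (φ z) :=
  (hφ.isIntegralCurve z).continuous

theorem neg_apply (hφ : IsFlowOf F φ) (hF : IsTameField F C) (z : ℂ) (t : ℝ) :
    φ (φ z t) (-t) = z := by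
  rw [← hφ.add hF, add_neg_cancel, hφ.zero]

theorem apply_neg (hφ : IsFlowOf F φ) (hF : IsTameField F C) (z : ℂ) (t : ℝ) :
    φ (φ z (-t)) t = z := by
  rw [← hφ.add hF, neg_add_cancel, hφ.zero]

theorem isIntegralCurve_neg (hφ : IsFlowOf F φ) (z : ℂ) :
    IsIntegralCurve (fun t ↦ φ z (-t)) (fun _ z ↦ -F z) := fun t ↦ by
  simpa [Function.comp_def] using (hφ.isIntegralCurve z (-t)).scomp t (hasDerivAt_neg t)

theorem norm_sub_le (hφ : IsFlowOf F φ) (hF : IsTameField F C) (z w : ℂ) (t : ℝ) :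
    ‖φ z t - φ w t‖ ≤ ‖z - w‖ * Real.exp (C * |t|) := by
  have e : ((C.toNNReal : ℝ≥0) : ℝ) = C := Real.coe_toNNReal _ hF.pos.le
  rcases le_total 0 t with ht | ht
  · have := (hφ.isIntegralCurve z).dist_le_of_lipschitz (fun _ ↦ hF.lipschitzWith)
      (hφ.isIntegralCurve w) ht
    rw [abs_of_nonneg ht]
    rwa [hφ.zero, hφ.zero, dist_eq_norm, dist_eq_norm, e] at this
  · have := (hφ.isIntegralCurve_neg z).dist_le_of_lipschitz (fun _ ↦ hF.lipschitzWith_neg)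
      (hφ.isIntegralCurve_neg w) (t := -t) (by linarith)
    rw [abs_of_nonpos ht]
    rwa [neg_neg, neg_zero, hφ.zero, hφ.zero, dist_eq_norm, dist_eq_norm, e] at this

theorem continuous_left (hφ : IsFlowOf F φ) (hF : IsTameField F C) (t : ℝ) :
    Continuous (fun z ↦ φ z t) := by
  have : LipschitzWith (Real.exp (C * |t|)).toNNReal (fun z ↦ φ z t) :=
    LipschitzWith.of_dist_le_mul fun z w ↦ by
      rw [dist_eq_norm, dist_eq_norm, Real.coe_toNNReal _ (Real.exp_pos _).le, mul_comm]
      exact hφ.norm_sub_le hF z w t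
  exact this.continuous

theorem norm_apply_sub_le (hφ : IsFlowOf F φ) (hF : IsTameField F C) (z : ℂ) (s t : ℝ) :
    ‖φ z t - φ z s‖ ≤ C * |t - s| := by
  simpa using convex_univ.norm_image_sub_le_of_norm_hasDerivWithin_le
    (f := φ z) (fun t _ ↦ (hφ.isIntegralCurve z t).hasDerivWithinAt)
    (fun t _ ↦ hF.norm_le _) (mem_univ s) (mem_univ t)

theorem norm_apply_sub_self_le (hφ : IsFlowOf F φ) (hF : IsTameField F C) (z : ℂ) (t : ℝ) :
    ‖φ z t - z‖ ≤ C * |t| := by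
  simpa [hφ.zero] using hφ.norm_apply_sub_le hF z 0 t

theorem apply_add_of_periodic (hφ : IsFlowOf F φ) (hF : IsTameField F C) {k : ℂ}
    (hk : ∀ z, F (z + k) = F z) (z : ℂ) (t : ℝ) : φ (z + k) t = φ z t + k := by
  have h := hφ.eq_of_isIntegralCurve hF (γ := fun t ↦ φ z t + k) fun t ↦ by
    simpa [hk] using (hφ.isIntegralCurve z t).add_const k
  simp only [hφ.zero] at h
  rw [h]

/-- Near `p` the orbits cross the normal line at `p` at a definite speed. -/
theorem half_le_re_sub (hφ : IsFlowOf F φ) (hF : IsTameField F C) {p y : ℂ}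
    (hy : ‖y - p‖ ≤ 1 / (8 * C ^ 4)) {a b : ℝ} (ha : |a| ≤ 1 / (4 * C ^ 3))
    (hb : |b| ≤ 1 / (4 * C ^ 3)) (hab : a ≤ b) :
    (b - a) / 2 ≤ ((φ y b - p) / F p).re - ((φ y a - p) / F p).re := by
  have hC := hF.pos
  have hder : ∀ t, HasDerivAt (fun t ↦ ((φ y t - p) / F p).re) (F (φ y t) / F p).re t := fun t ↦ by
    have h := (((hφ.isIntegralCurve y t).sub_const p).div_const (F p))
    exact (Complex.reCLM.hasFDerivAt.comp_hasDerivAt t h)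
  have := (convex_Icc (-(1 / (4 * C ^ 3))) (1 / (4 * C ^ 3))).mul_sub_le_image_sub_of_le_deriv
    (f := fun t ↦ ((φ y t - p) / F p).re) (C := 1 / 2)
    (fun t _ ↦ (hder t).continuousAt.continuousWithinAt)
    (fun t _ ↦ (hder t).differentiableAt.differentiableWithinAt) ?_ a (abs_le.1 ha) b
    (abs_le.1 hb) hab
  · linarith
  intro t ht
  rw [interior_Icc] at ht
  have ht' : |t| ≤ 1 / (4 * C ^ 3) := abs_le.2 ⟨ht.1.le, ht.2.le⟩
  rw [(hder t).deriv]
  have h1 : ‖φ y t - p‖ ≤ 1 / (8 * C ^ 4) + C * (1 / (4 * C ^ 3)) := by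
    calc ‖φ y t - p‖ = ‖(y - p) + (φ y t - y)‖ := by ring_nf
      _ ≤ ‖y - p‖ + ‖φ y t - y‖ := norm_add_le _ _
      _ ≤ _ := add_le_add hy ((hφ.norm_apply_sub_self_le hF y t).trans (by gcongr))
  have h2 : ‖F (φ y t) / F p - 1‖ ≤ 1 / 2 := by
    rw [div_sub_one (hF.ne_zero p), norm_div, div_le_iff₀ (hF.norm_pos p)]
    have h3 := hF.le_norm p
    have h4 : C * ‖φ y t - p‖ ≤ 1 / (2 * C) := by
      have h5 : C * (1 / (8 * C ^ 4) + C * (1 / (4 * C ^ 3))) =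
          1 / (2 * C) * (1 / (4 * C ^ 2) + 1 / 2) := by
        field_simp
        ring
      have h6 : 1 / (4 * C ^ 2) ≤ 1 / 2 := by
        have : 1 ≤ C ^ 2 := one_le_pow₀ hF.one_le
        apply one_div_le_one_div_of_le <;> linarith
      calc C * ‖φ y t - p‖ ≤ 1 / (2 * C) * (1 / (4 * C ^ 2) + 1 / 2) := by
            rw [← h5]; gcongr
        _ ≤ 1 / (2 * C) * 1 := by gcongr; linarith
        _ = _ := mul_one _
    refine (hF.lip _ _).trans (h4.trans ?_)
    rw [div_le_iff₀ (by positivity)]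
    linarith
  have h7 := abs_le.1 ((abs_re_le_norm _).trans h2)
  rw [sub_re, one_re] at h7
  linarith [h7.1]

/-- Near `p` every orbit crosses the normal line at `p`. -/
theorem exists_re_eq_zero (hφ : IsFlowOf F φ) (hF : IsTameField F C) {p y : ℂ}
    (hy : ‖y - p‖ ≤ 1 / (8 * C ^ 4)) :
    ∃ τ, |τ| ≤ 1 / (4 * C ^ 3) ∧ |τ| ≤ 2 * |((y - p) / F p).re| ∧
      ((φ y τ - p) / F p).re = 0 := by
  have hC := hF.pos
  set u : ℝ → ℝ := fun t ↦ ((φ y t - p) / F p).re with hu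
  have hcont : Continuous u := by
    have := hφ.continuous y
    simp only [hu]
    fun_prop
  have h0 : u 0 = ((y - p) / F p).re := by simp [hu, hφ.zero]
  have hr : 0 < 1 / (4 * C ^ 3) := by positivity
  have h1 : |u 0| ≤ 1 / (8 * C ^ 3) := by
    rw [h0]
    refine (abs_re_le_norm _).trans ?_
    rw [norm_div, div_le_iff₀ (hF.norm_pos p)]
    have h3 := hF.le_norm p
    have h4 : 1 / (8 * C ^ 3) * ‖F p‖ = 1 / (8 * C ^ 4) * (C * ‖F p‖) := by
      field_simp
    rw [h4]
    refine hy.trans (le_mul_of_one_le_right (by positivity) h3)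
  have hhalf : 1 / (4 * C ^ 3) / 2 = 1 / (8 * C ^ 3) := by
    field_simp
    norm_num
  have ha : |(0 : ℝ)| ≤ 1 / (4 * C ^ 3) := by rw [abs_zero]; exact hr.le
  have hpos : 0 ≤ u (1 / (4 * C ^ 3)) := by
    have := hφ.half_le_re_sub hF hy (a := 0) (b := 1 / (4 * C ^ 3)) ha (by rw [abs_of_pos hr]) hr.le
    rw [sub_zero, hhalf] at this
    linarith [(abs_le.1 h1).1]
  have hneg : u (-(1 / (4 * C ^ 3))) ≤ 0 := by
    have := hφ.half_le_re_sub hF hy (a := -(1 / (4 * C ^ 3))) (b := 0)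
      (by rw [abs_neg, abs_of_pos hr]) ha (by linarith)
    rw [zero_sub, neg_neg, hhalf] at this
    linarith [(abs_le.1 h1).2]
  obtain ⟨τ, hτ, hτ0⟩ := intermediate_value_Icc (a := -(1 / (4 * C ^ 3))) (b := 1 / (4 * C ^ 3))
    (by linarith) hcont.continuousOn (show (0 : ℝ) ∈ Icc _ _ from ⟨hneg, hpos⟩)
  have hτ' := abs_le.2 hτ
  refine ⟨τ, hτ', ?_, hτ0⟩
  rw [← h0]
  rcases le_total 0 τ with h | h
  · have := hφ.half_le_re_sub hF hy ha hτ' h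
    rw [abs_of_nonneg h]
    have h2 := neg_abs_le (u 0)
    simp only [hu] at *
    linarith
  · have := hφ.half_le_re_sub hF hy hτ' ha h
    rw [abs_of_nonpos h]
    have h2 := le_abs_self (u 0)
    simp only [hu] at *
    linarith

/-- The crossing time of the normal line at `p` is a Lipschitz function of the point. -/
theorem abs_crossing_sub_le (hφ : IsFlowOf F φ) (hF : IsTameField F C) {p y y' : ℂ}
    (hy : ‖y - p‖ ≤ 1 / (8 * C ^ 4)) {τ τ' : ℝ}
    (hτ : |τ| ≤ 1 / (4 * C ^ 3)) (hτ' : |τ'| ≤ 1 / (4 * C ^ 3))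
    (h0 : ((φ y τ - p) / F p).re = 0) (h0' : ((φ y' τ' - p) / F p).re = 0) :
    |τ - τ'| ≤ 2 * (C * (‖y - y'‖ * Real.exp C)) := by
  have hC := hF.pos
  have h1 : |τ - τ'| ≤ 2 * |((φ y τ - p) / F p).re - ((φ y τ' - p) / F p).re| := by
    rcases le_total τ' τ with h | h
    · have := hφ.half_le_re_sub hF hy hτ' hτ h
      rw [abs_of_nonneg (sub_nonneg.2 h)]
      linarith [le_abs_self (((φ y τ - p) / F p).re - ((φ y τ' - p) / F p).re)]
    · have := hφ.half_le_re_sub hF hy hτ hτ' h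
      rw [abs_of_nonpos (sub_nonpos.2 h)]
      linarith [neg_abs_le (((φ y τ - p) / F p).re - ((φ y τ' - p) / F p).re)]
  refine h1.trans ?_
  gcongr
  rw [h0, ← h0', ← sub_re, ← sub_div, sub_sub_sub_cancel_right]
  refine (abs_re_le_norm _).trans ?_
  rw [norm_div, div_le_iff₀ (hF.norm_pos p)]
  have h2 := hφ.norm_sub_le hF y' y τ'
  have h3 : Real.exp (C * |τ'|) ≤ Real.exp C := by
    apply Real.exp_le_exp.2
    refine mul_le_of_le_one_right hC.le (hτ'.trans ?_)
    have : 1 ≤ C ^ 3 := one_le_pow₀ hF.one_le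
    rw [div_le_one (by positivity)]
    linarith
  have h4 := hF.le_norm p
  rw [norm_sub_rev y' y] at h2
  calc ‖φ y' τ' - φ y τ'‖ ≤ ‖y - y'‖ * Real.exp C := h2.trans (by gcongr)
    _ ≤ (‖y - y'‖ * Real.exp C) * (C * ‖F p‖) := le_mul_of_one_le_right (by positivity) h4
    _ = _ := by ring

end IsFlowOf

theorem eq_normalPoint_of_re_eq_zero (hF : IsTameField F C) (hκ : |κ| = 1) {p z : ℂ}
    (h : ((z - p) / F p).re = 0) : z = normalPoint F κ p (κ * ((z - p) / F p).im) := by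
  have h0 := hF.ne_zero p
  have hκ2 : κ * κ = 1 := by rw [← abs_mul_abs_self, hκ, one_mul]
  have h1 : ((κ * ((z - p) / F p).im : ℝ) : ℂ) * normalUnit κ = (z - p) / F p := by
    apply Complex.ext
    · simp [normalUnit, h]
    · simp [normalUnit]
      linear_combination ((z - p) / F p).im * hκ2
  rw [normalPoint, ← mul_assoc, h1, div_mul_cancel₀ _ h0]
  ring

theorem im_normalPoint (hF : IsTameField F C) (hκ : |κ| = 1) (p : ℂ) (s : ℝ) :
    κ * ((normalPoint F κ p s - p) / F p).im = s := by
  have h0 := hF.ne_zero p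
  have hκ2 : κ * κ = 1 := by rw [← abs_mul_abs_self, hκ, one_mul]
  have : (normalPoint F κ p s - p) / F p = s * normalUnit κ := by
    rw [normalPoint]
    field_simp
    ring
  rw [this]
  simp [normalUnit]
  linear_combination s * hκ2

/-- Normal gaps based at points of an invariant set do not meet unless they have the same base. -/
theorem IsFlowOf.eq_of_normalPoint_eq_of_le (hφ : IsFlowOf F φ) (hF : IsTameField F C)
    (hκ : |κ| = 1) {M : Set ℂ} (hM : ∀ z ∈ M, ∀ t, φ z t ∈ M) {x x' : ℂ} (hx : x ∈ M)
    {s s' : ℝ} (hs : 0 < s) (hss' : s ≤ s') (hs' : s' ≤ stripWidth C) (hgap : IsGap F κ M x' s')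
    (h : normalPoint F κ x s = normalPoint F κ x' s') : x = x' := by
  have hC := hF.pos
  have hC1 := hF.one_le
  set d := ‖x - x'‖ with hd
  set u := s' - s with hu
  have hu0 : 0 ≤ u := sub_nonneg.2 hss'
  have hj := norm_normalUnit hκ
  have e1 : x - x' = u * (normalUnit κ * F x') + s * (normalUnit κ * (F x' - F x)) := by
    simp only [normalPoint] at h
    rw [hu]
    push_cast
    linear_combination h
  have hFd : ‖F x' - F x‖ ≤ C * d := by
    rw [hd, norm_sub_rev x x']
    exact hF.lip _ _
  have hCs : C * s ≤ 1 / 16 := by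
    have := hF.mul_abs_le (s := s) (by rw [abs_of_pos hs]; linarith)
    rwa [abs_of_pos hs] at this
  have hd0 : 0 ≤ d := norm_nonneg _
  have hdu : d ≤ 2 * C * u := by
    have : d ≤ u * C + s * (C * d) := by
      conv_lhs => rw [hd, e1]
      refine (norm_add_le _ _).trans ?_
      simp only [norm_mul, hj, one_mul, Complex.norm_real, Real.norm_eq_abs, abs_of_nonneg hu0,
        abs_of_pos hs]
      have := hF.norm_le x'
      gcongr
    nlinarith [mul_nonneg hC.le hu0]
  rcases hu0.eq_or_lt with h0 | hupos
  · rw [← h0, mul_zero] at hdu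
    exact sub_eq_zero.1 (norm_eq_zero.1 (le_antisymm hdu hd0))
  exfalso
  have hF0 := hF.ne_zero x'
  set e : ℂ := s * (normalUnit κ * (F x' - F x)) / F x' with he
  have e2 : (x - x') / F x' = u * normalUnit κ + e := by
    rw [e1, he]
    field_simp
  have hne : ‖e‖ ≤ 2 * C ^ 3 * s * u := by
    rw [he, norm_div, div_le_iff₀ (hF.norm_pos x')]
    simp only [norm_mul, hj, one_mul, Complex.norm_real, Real.norm_eq_abs, abs_of_pos hs]
    calc s * ‖F x' - F x‖ ≤ s * (C * (2 * C * u)) := by gcongr; exact hFd.trans (by gcongr)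
      _ ≤ s * (C * (2 * C * u)) * (C * ‖F x'‖) :=
        le_mul_of_one_le_right (by positivity) (hF.le_norm x')
      _ = _ := by ring
  have husw : u ≤ stripWidth C := by linarith
  obtain ⟨τ, -, hτ, hτ0⟩ := hφ.exists_re_eq_zero hF (p := x') (y := x) (by
    calc ‖x - x'‖ ≤ 2 * C * u := hdu
      _ ≤ 2 * C * stripWidth C := by gcongr
      _ = 1 / (8 * C ^ 4) := by
        unfold stripWidth
        field_simp
        norm_num)
  have hτe : |τ| ≤ 2 * ‖e‖ := by
    refine hτ.trans ?_
    gcongr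
    rw [e2]
    simpa [normalUnit] using abs_re_le_norm e
  have hpt := eq_normalPoint_of_re_eq_zero hF hκ hτ0
  set σ := κ * ((φ x τ - x') / F x').im with hσ
  have hκ2 : κ * κ = 1 := by rw [← abs_mul_abs_self, hκ, one_mul]
  have e3 : σ - u = κ * (e + (φ x τ - x) / F x').im := by
    have : (φ x τ - x') / F x' = u * normalUnit κ + (e + (φ x τ - x) / F x') := by
      rw [← add_assoc, ← e2]
      ring
    rw [hσ, this]
    simp [normalUnit]
    linear_combination u * hκ2
  have h4 : |σ - u| ≤ 6 * C ^ 5 * s * u := by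
    rw [e3, abs_mul, hκ, one_mul]
    refine (abs_im_le_norm _).trans ((norm_add_le _ _).trans ?_)
    have h5 : ‖(φ x τ - x) / F x'‖ ≤ 2 * C ^ 2 * ‖e‖ := by
      rw [norm_div, div_le_iff₀ (hF.norm_pos x')]
      calc ‖φ x τ - x‖ ≤ C * (2 * ‖e‖) :=
            (hφ.norm_apply_sub_self_le hF x τ).trans (by gcongr)
        _ ≤ C * (2 * ‖e‖) * (C * ‖F x'‖) :=
          le_mul_of_one_le_right (by positivity) (hF.le_norm x')
        _ = _ := by ring
    have h6 : 1 ≤ C ^ 2 := one_le_pow₀ hC1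
    calc ‖e‖ + ‖(φ x τ - x) / F x'‖ ≤ 3 * C ^ 2 * ‖e‖ := by nlinarith [norm_nonneg e]
      _ ≤ 3 * C ^ 2 * (2 * C ^ 3 * s * u) := by gcongr
      _ = _ := by ring
  have hw : ∀ {a : ℝ}, a ≤ stripWidth C → 6 * C ^ 5 * a ≤ 6 / 16 := fun {a} ha ↦ by
    calc 6 * C ^ 5 * a ≤ 6 * C ^ 5 * stripWidth C := by gcongr
      _ = _ := by
        unfold stripWidth
        field_simp
  have hws := hw (show s ≤ stripWidth C by linarith)
  have hwu := hw husw
  have h7 := abs_le.1 h4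
  have h8 : 6 * C ^ 5 * s * u ≤ 6 / 16 * u := by gcongr
  have h9 : 6 * C ^ 5 * s * u ≤ 6 / 16 * s := by
    calc 6 * C ^ 5 * s * u = 6 * C ^ 5 * u * s := by ring
      _ ≤ _ := by gcongr
  refine hgap σ (by linarith [h7.1]) (by linarith [h7.2]) ?_
  rw [← hpt]
  exact hM x hx τ

theorem IsFlowOf.eq_of_normalPoint_eq (hφ : IsFlowOf F φ) (hF : IsTameField F C)
    (hκ : |κ| = 1) {M : Set ℂ} (hM : ∀ z ∈ M, ∀ t, φ z t ∈ M) {x x' : ℂ} (hx : x ∈ M) (hx' : x' ∈ M)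
    {s s' : ℝ} (hs : 0 < s) (hs' : 0 < s') (hsw : s ≤ stripWidth C) (hsw' : s' ≤ stripWidth C)
    (hgap : IsGap F κ M x s) (hgap' : IsGap F κ M x' s')
    (h : normalPoint F κ x s = normalPoint F κ x' s') : x = x' ∧ s = s' := by
  have hxx : x = x' := by
    rcases le_total s s' with h1 | h1
    · exact hφ.eq_of_normalPoint_eq_of_le hF hκ hM hx hs h1 hsw' hgap' h
    · exact (hφ.eq_of_normalPoint_eq_of_le hF hκ hM hx' hs' h1 hsw hgap h.symm).symm
  subst hxx
  refine ⟨rfl, ?_⟩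
  rw [← im_normalPoint hF hκ x s, h, im_normalPoint hF hκ]

end FlowSections

section NormalCurves

open Set Metric Complex
open scoped NNReal

theorem IsIntegralCurve.lt_of_lipschitz {v : ℝ → ℝ → ℝ} {K : ℝ≥0}
    (hv : ∀ t, LipschitzWith K (v t)) {f g : ℝ → ℝ} (hf : IsIntegralCurve f v)
    (hg : IsIntegralCurve g v) {t₀ : ℝ} (h : f t₀ < g t₀) (t : ℝ) : f t < g t := by
  by_contra! hlt
  have hc : Continuous (fun t ↦ g t - f t) := hg.continuous.sub hf.continuous
  obtain ⟨u, hu⟩ := mem_range_of_exists_le_of_exists_ge hc (c := 0)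
    ⟨t, sub_nonpos.2 hlt⟩ ⟨t₀, (sub_pos.2 h).le⟩
  have := hf.eq_of_lipschitz hv hg (t₀ := u) (sub_eq_zero.1 hu).symm
  rw [this] at h
  exact lt_irrefl _ h

theorem IsIntegralCurve.le_of_lipschitz {v : ℝ → ℝ → ℝ} {K : ℝ≥0}
    (hv : ∀ t, LipschitzWith K (v t)) {f g : ℝ → ℝ} (hf : IsIntegralCurve f v)
    (hg : IsIntegralCurve g v) {t₀ : ℝ} (h : f t₀ ≤ g t₀) (t : ℝ) : f t ≤ g t := by
  by_contra! hlt
  exact absurd (hg.lt_of_lipschitz hv hf hlt t₀) (not_lt.2 h)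

variable {F : ℂ → ℂ} {C κ : ℝ} {φ : ℂ → ℝ → ℂ} {p : ℂ}

/-- The equation of the normal coordinate along the curve `v`, cut off outside the strip. -/
noncomputable def normalField (F : ℂ → ℂ) (κ C : ℝ) (v : ℝ → ℂ) (t s : ℝ) : ℝ :=
  normalRate F κ (v t) (clamp (stripWidth C) s)

namespace IsTameField

theorem abs_clamp_stripWidth_le (hF : IsTameField F C) (s : ℝ) :
    |clamp (stripWidth C) s| ≤ stripWidth C := abs_clamp_le (stripWidth_pos hF.one_le).le s

theorem mul_abs_clamp_le (hF : IsTameField F C) (s : ℝ) :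
    C * |clamp (stripWidth C) s| ≤ 1 / 16 := hF.mul_abs_le (hF.abs_clamp_stripWidth_le s)

theorem abs_normalField_sub_le (hF : IsTameField F C) (hκ : |κ| = 1) (v : ℝ → ℂ) (t s s' : ℝ) :
    |normalField F κ C v t s - normalField F κ C v t s'| ≤ 4 * C * |s - s'| := by
  refine (hF.abs_normalRate_sub hκ _ (hF.mul_abs_clamp_le s) (hF.mul_abs_clamp_le s')).trans ?_
  have := hF.pos
  exact mul_le_mul_of_nonneg_left (abs_clamp_sub_le _ _ _) (by positivity)

theorem normalField_zero (hF : IsTameField F C) (v : ℝ → ℂ) (t : ℝ) :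
    normalField F κ C v t 0 = 0 := by
  rw [normalField, clamp_of_abs_le (by simpa using (stripWidth_pos hF.one_le).le),
    hF.normalRate_zero]

theorem abs_normalField_le (hF : IsTameField F C) (hκ : |κ| = 1) (v : ℝ → ℂ) (t s : ℝ) :
    |normalField F κ C v t s| ≤ 4 * C * |s| := by
  simpa [hF.normalField_zero] using hF.abs_normalField_sub_le hκ v t s 0

theorem lipschitzWith_normalField (hF : IsTameField F C) (hκ : |κ| = 1) (v : ℝ → ℂ) (t : ℝ) :
    LipschitzWith (4 * C).toNNReal (normalField F κ C v t) :=
  LipschitzWith.of_dist_le_mul fun s s' ↦ by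
    have := hF.pos
    rw [Real.dist_eq, Real.dist_eq, Real.coe_toNNReal _ (by positivity)]
    exact hF.abs_normalField_sub_le hκ v t s s'

theorem abs_normalField_le_one (hF : IsTameField F C) (hκ : |κ| = 1) (v : ℝ → ℂ) (t s : ℝ) :
    |normalField F κ C v t s| ≤ 1 := by
  have h := hF.abs_normalRate_sub hκ (v t) (hF.mul_abs_clamp_le s) (t := 0) (by simp)
  rw [hF.normalRate_zero, sub_zero, sub_zero] at h
  have := hF.mul_abs_clamp_le s
  rw [normalField]
  linarith

theorem continuous_timeRate (hF : IsTameField F C) (hκ : |κ| = 1) {v : ℝ → ℂ}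
    (hv : Continuous v) {s : ℝ → ℝ} (hs : Continuous s) (h : ∀ t, C * |s t| ≤ 1 / 16) :
    Continuous (fun t ↦ timeRate F κ (v t) (s t)) := by
  have c1 := hF.contDiff.continuous
  have c2 : Continuous (fderiv ℝ F) := hF.contDiff.continuous_fderiv (by norm_num)
  unfold timeRate frameRatio frameRate normalPoint
  refine Continuous.div ?_ ?_ fun t ↦ ?_
  · refine continuous_const.add (hs.mul (continuous_re.comp ?_))
    refine Continuous.div ?_ (c1.comp hv) fun t ↦ hF.ne_zero _
    exact continuous_const.mul ((c2.comp hv).clm_apply (c1.comp hv))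
  · refine continuous_re.comp (Continuous.div (c1.comp ?_) (c1.comp hv) fun t ↦ hF.ne_zero _)
    have := c1.comp hv
    simp only [Function.comp_def] at this
    fun_prop
  · have := (hF.re_frameRatio_bounds hκ (v t) (h t)).1
    simp only [frameRatio, normalPoint] at this
    linarith

theorem continuous_normalRate (hF : IsTameField F C) (hκ : |κ| = 1) {v : ℝ → ℂ}
    (hv : Continuous v) {s : ℝ → ℝ} (hs : Continuous s) (h : ∀ t, C * |s t| ≤ 1 / 16) :
    Continuous (fun t ↦ normalRate F κ (v t) (s t)) := by
  have c1 := hF.contDiff.continuous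
  have c2 : Continuous (fderiv ℝ F) := hF.contDiff.continuous_fderiv (by norm_num)
  unfold normalRate
  refine continuous_const.mul (((hF.continuous_timeRate hκ hv hs h).mul ?_).sub (hs.mul ?_))
  · unfold frameRatio normalPoint
    refine continuous_im.comp (Continuous.div (c1.comp ?_) (c1.comp hv) fun t ↦ hF.ne_zero _)
    have := c1.comp hv
    simp only [Function.comp_def] at this
    fun_prop
  · unfold frameRate
    refine continuous_im.comp (Continuous.div ?_ (c1.comp hv) fun t ↦ hF.ne_zero _)
    exact continuous_const.mul ((c2.comp hv).clm_apply (c1.comp hv))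

theorem exists_normalCurve (hF : IsTameField F C) (hκ : |κ| = 1) {v : ℝ → ℂ}
    (hv : Continuous v) (t₀ s₀ : ℝ) :
    ∃ σ : ℝ → ℝ, σ t₀ = s₀ ∧ IsIntegralCurve σ (normalField F κ C v) :=
  exists_isIntegralCurve_of_lipschitz_of_bounded (B := 1)
    (hF.lipschitzWith_normalField hκ v)
    (fun _ ↦ hF.continuous_normalRate hκ hv continuous_const fun _ ↦ hF.mul_abs_clamp_le _)
    (fun t s ↦ by simpa using hF.abs_normalField_le_one hκ v t s) t₀ s₀

theorem isIntegralCurve_zero (hF : IsTameField F C) (v : ℝ → ℂ) :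
    IsIntegralCurve (fun _ ↦ 0) (normalField F κ C v) := fun t ↦ by
  rw [hF.normalField_zero]
  exact hasDerivAt_const _ _

variable {v : ℝ → ℂ} {w : ℝ → ℝ}

theorem normalCurve_pos (hF : IsTameField F C) (hκ : |κ| = 1)
    (hw : IsIntegralCurve w (normalField F κ C v)) {t₀ : ℝ} (h : 0 < w t₀) (t : ℝ) : 0 < w t :=
  (hF.isIntegralCurve_zero v).lt_of_lipschitz (hF.lipschitzWith_normalField hκ v) hw h t

theorem monotone_mul_exp (hF : IsTameField F C) (hκ : |κ| = 1)
    (hw : IsIntegralCurve w (normalField F κ C v)) (hpos : ∀ t, 0 < w t) :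
    Monotone (fun t ↦ w t * Real.exp (4 * C * t)) := by
  have hd : ∀ t, HasDerivAt (fun t ↦ w t * Real.exp (4 * C * t))
      (normalField F κ C v t (w t) * Real.exp (4 * C * t) +
        w t * (Real.exp (4 * C * t) * (4 * C))) t := fun t ↦ by
    refine (hw t).mul (HasDerivAt.exp ?_)
    simpa using (hasDerivAt_id t).const_mul (4 * C)
  refine monotone_of_hasDerivAt_nonneg hd fun t ↦ ?_
  have h := (abs_le.1 (hF.abs_normalField_le hκ v t (w t))).1
  rw [abs_of_pos (hpos t)] at h
  have : 0 ≤ (normalField F κ C v t (w t) + 4 * C * w t) * Real.exp (4 * C * t) :=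
    mul_nonneg (by linarith) (Real.exp_pos _).le
  simp only [Pi.zero_apply]
  linarith

end IsTameField

namespace IsFlowOf

/-- A solution of the normal equation traces an orbit of the flow. -/
theorem exists_normalPoint_eq (hφ : IsFlowOf F φ) (hF : IsTameField F C) (hκ : |κ| = 1)
    {σ : ℝ → ℝ} (hσ : IsIntegralCurve σ (normalField F κ C (φ p))) {a b : ℝ} (hab : a ≤ b)
    (hle : ∀ t ∈ Icc a b, |σ t| ≤ stripWidth C) :
    ∃ θ, (b - a) / 2 ≤ θ ∧
      normalPoint F κ (φ p b) (σ b) = φ (normalPoint F κ (φ p a) (σ a)) θ := by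
  set ε := stripWidth C
  set α : ℝ → ℝ := fun t ↦ timeRate F κ (φ p t) (clamp ε (σ t)) with hα
  have hαc : Continuous α := hF.continuous_timeRate hκ (hφ.continuous p)
    ((continuous_clamp _).comp hσ.continuous) fun t ↦ hF.mul_abs_clamp_le _
  have hαb : ∀ t, 1 / 2 ≤ α t ∧ α t ≤ 2 := fun t ↦ hF.timeRate_bounds hκ _ (hF.mul_abs_clamp_le _)
  set Θ : ℝ → ℝ := fun t ↦ ∫ u in a..t, α u with hΘ
  have hΘd : ∀ t, HasDerivAt Θ (α t) t := fun t ↦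
    intervalIntegral.integral_hasDerivAt_right (hαc.intervalIntegrable _ _)
      hαc.aestronglyMeasurable.stronglyMeasurableAtFilter hαc.continuousAt
  have hΘa : Θ a = 0 := by simp [hΘ]
  refine ⟨Θ b, ?_, ?_⟩
  · have := convex_univ.mul_sub_le_image_sub_of_le_deriv (f := Θ) (C := 1 / 2)
      (fun t _ ↦ (hΘd t).continuousAt.continuousWithinAt)
      (fun t _ ↦ (hΘd t).differentiableAt.differentiableWithinAt)
      (fun t _ ↦ by rw [(hΘd t).deriv]; exact (hαb t).1) a (mem_univ a) b (mem_univ b) hab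
    linarith
  set c : ℝ → ℂ := fun t ↦ normalPoint F κ (φ p t) (σ t) with hc
  have hcd : ∀ t ∈ Icc a b, HasDerivAt c (α t * F (c t)) t := fun t ht ↦ by
    have h1 := hφ.isIntegralCurve p t
    have h2 : HasDerivAt (fun t ↦ F (φ p t)) (fderiv ℝ F (φ p t) (F (φ p t))) t :=
      ((hF.contDiff.differentiable (by norm_num) _).hasFDerivAt).comp_hasDerivAt t h1
    have h3 := h1.add ((hσ t).ofReal_comp.mul (h2.const_mul (normalUnit κ)))
    have h4 : clamp ε (σ t) = σ t := clamp_of_abs_le (hle t ht)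
    have h5 := hF.timeRate_mul hκ (φ p t) (hF.mul_abs_le (hle t ht))
    simp only [hα, hc, h4]
    rw [← h5]
    refine h3.congr_deriv ?_
    rw [normalField, h4]
    ring
  have hgd : ∀ t, HasDerivAt (fun t ↦ φ (c a) (Θ t)) (α t * F (φ (c a) (Θ t))) t := fun t ↦ by
    have := (hφ.isIntegralCurve (c a) (Θ t)).scomp t (hΘd t)
    simpa [Function.comp_def] using this
  have hlip : ∀ t ∈ Ico a b, LipschitzOnWith (2 * C).toNNReal (fun z ↦ (α t : ℂ) * F z) univ := by
    intro t _
    refine (LipschitzWith.of_dist_le_mul fun z z' ↦ ?_).lipschitzOnWith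
    have := hF.pos
    rw [dist_eq_norm, dist_eq_norm, ← mul_sub, norm_mul, Real.coe_toNNReal _ (by positivity),
      Complex.norm_real, Real.norm_eq_abs, abs_of_nonneg (by linarith [(hαb t).1]), mul_assoc]
    exact mul_le_mul (hαb t).2 (hF.lip _ _) (norm_nonneg _) (by norm_num)
  have := ODE_solution_unique_of_mem_Icc_right (v := fun t z ↦ (α t : ℂ) * F z)
    (s := fun _ ↦ univ) (f := c) (g := fun t ↦ φ (c a) (Θ t)) hlip
    (fun t ht ↦ (hcd t ht).continuousAt.continuousWithinAt)
    (fun t ht ↦ (hcd t (Ico_subset_Icc_self ht)).hasDerivWithinAt) (fun _ _ ↦ mem_univ _)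
    (fun t ht ↦ (hgd t).continuousAt.continuousWithinAt)
    (fun t ht ↦ (hgd t).hasDerivWithinAt) (fun _ _ ↦ mem_univ _)
    (by simp [hΘa, hφ.zero])
  exact this (right_mem_Icc.2 hab)

variable {M : Set ℂ} {w : ℝ → ℝ}

/-- Gaps are carried along by solutions of the normal equation. -/
theorem isGap_of_normalCurve (hφ : IsFlowOf F φ) (hF : IsTameField F C) (hκ : |κ| = 1)
    (hM : ∀ z ∈ M, ∀ t, φ z t ∈ M) (hw : IsIntegralCurve w (normalField F κ C (φ p)))
    {a b : ℝ} (hab : a ≤ b) (hle : ∀ t ∈ Icc a b, w t ≤ stripWidth C)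
    (hgap : IsGap F κ M (φ p a) (w a)) : IsGap F κ M (φ p b) (w b) := by
  intro r hr hrw hmem
  obtain ⟨σ, hσb, hσ⟩ := hF.exists_normalCurve hκ (hφ.continuous p) b r
  have hpos := hF.normalCurve_pos hκ hσ (t₀ := b) (by rwa [hσb])
  have hσw := hσ.le_of_lipschitz (hF.lipschitzWith_normalField hκ _) hw (t₀ := b) (by rwa [hσb])
  obtain ⟨θ, -, hθ⟩ := hφ.exists_normalPoint_eq hF hκ hσ hab fun t ht ↦ by
    rw [abs_of_pos (hpos t)]
    exact (hσw t).trans (hle t ht)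
  refine hgap (σ a) (hpos a) (hσw a) ?_
  rw [hσb] at hθ
  have := hM _ hmem (-θ)
  rwa [hθ, hφ.neg_apply hF] at this

theorem isGap_mul_exp (hφ : IsFlowOf F φ) (hF : IsTameField F C) (hκ : |κ| = 1)
    (hM : ∀ z ∈ M, ∀ t, φ z t ∈ M) {s : ℝ} (hs : 0 < s) (hsw : s ≤ stripWidth C)
    (hgap : IsGap F κ M p s) {τ : ℝ} (hτ : 0 ≤ τ) :
    IsGap F κ M (φ p τ) (s * Real.exp (-(4 * C * τ))) := by
  obtain ⟨w, hwτ, hw⟩ := hF.exists_normalCurve hκ (hφ.continuous p) τ (s * Real.exp (-(4 * C * τ)))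
  have hpos := hF.normalCurve_pos hκ hw (t₀ := τ) (by rw [hwτ]; positivity)
  have hle : ∀ t ∈ Icc 0 τ, w t ≤ s := fun t ht ↦ by
    have h1 : w t * Real.exp (4 * C * t) ≤ w τ * Real.exp (4 * C * τ) :=
      hF.monotone_mul_exp hκ hw hpos ht.2
    rw [hwτ, mul_assoc s, ← Real.exp_add, neg_add_cancel, Real.exp_zero, mul_one] at h1
    refine le_trans ?_ h1
    have hC := hF.pos
    have ht0 := ht.1
    exact le_mul_of_one_le_right (hpos t).le (Real.one_le_exp (by positivity))
  rw [← hwτ]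
  refine hφ.isGap_of_normalCurve hF hκ hM hw hτ (fun t ht ↦ (hle t ht).trans hsw) ?_
  rw [hφ.zero]
  exact hgap.mono (hle 0 (left_mem_Icc.2 hτ))

end IsFlowOf

end NormalCurves

section GapArea

open Set Metric Complex MeasureTheory
open scoped NNReal ENNReal

/-- The lattice `ℤ + ℤ I` in `ℂ`. -/
noncomputable abbrev intLattice : AddSubgroup ℂ :=
  (Submodule.span ℤ (range Complex.basisOneI)).toAddSubgroup

/-- `φ` is the flow of a tame lattice-periodic field, without periodic orbits modulo the lattice. -/
structure IsAperiodicFlow (F : ℂ → ℂ) (C : ℝ) (φ : ℂ → ℝ → ℂ) : Prop where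
  tame : IsTameField F C
  flow : IsFlowOf F φ
  map_add : ∀ k ∈ intLattice, ∀ z, F (z + k) = F z
  apply_ne : ∀ z, ∀ k ∈ intLattice, ∀ T, 0 < T → φ z T ≠ z + k

/-- `M` is closed, and invariant under the lattice and the flow `φ`. -/
structure IsInvariantSet (φ : ℂ → ℝ → ℂ) (M : Set ℂ) : Prop where
  isClosed : IsClosed M
  add_mem : ∀ z ∈ M, ∀ k ∈ intLattice, z + k ∈ M
  apply_mem : ∀ z ∈ M, ∀ t, φ z t ∈ M

theorem det_re_smul_add_im_smul (u v : ℂ) :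
    (reCLM.smulRight u + imCLM.smulRight v : ℂ →L[ℝ] ℂ).det = u.re * v.im - u.im * v.re := by
  rw [ContinuousLinearMap.det, ← LinearMap.det_toMatrix basisOneI, Matrix.det_fin_two]
  simp [LinearMap.toMatrix_apply]
  ring

variable {F : ℂ → ℂ} {C κ : ℝ} {φ : ℂ → ℝ → ℂ} {p : ℂ} {M : Set ℂ}

/-- The bound for the area of the set of all gaps along an orbit. -/
noncomputable def gapArea (C : ℝ) : ℝ :=
  2 * C ^ 2 * (volume (ZSpan.fundamentalDomain Complex.basisOneI)).toReal

theorem ofReal_gapArea (hC : 0 < C) : ENNReal.ofReal (gapArea C) =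
    ENNReal.ofReal (2 * C ^ 2) * volume (ZSpan.fundamentalDomain Complex.basisOneI) := by
  rw [gapArea, ENNReal.ofReal_mul (by positivity), ENNReal.ofReal_toReal]
  exact (ZSpan.fundamentalDomain_isBounded _).measure_lt_top.ne

namespace IsAperiodicFlow

theorem normalPoint_add (h : IsAperiodicFlow F C φ) {k : ℂ} (hk : k ∈ intLattice) (x : ℂ) (s : ℝ) :
    normalPoint F κ (x + k) s = normalPoint F κ x s + k := by
  rw [normalPoint, normalPoint, h.map_add k hk]
  ring

theorem apply_add (h : IsAperiodicFlow F C φ) {k : ℂ} (hk : k ∈ intLattice) (z : ℂ) (t : ℝ) :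
    φ (z + k) t = φ z t + k := h.flow.apply_add_of_periodic h.tame (h.map_add k hk) z t

theorem isGap_add (h : IsAperiodicFlow F C φ) (hM : IsInvariantSet φ M) {k x : ℂ}
    (hk : k ∈ intLattice) {s : ℝ} (hg : IsGap F κ M x s) : IsGap F κ M (x + k) s := by
  intro r h0 h1 hmem
  rw [h.normalPoint_add hk] at hmem
  have := hM.add_mem _ hmem (-k) (neg_mem hk)
  rw [add_neg_cancel_right] at this
  exact hg r h0 h1 this

theorem eq_of_normalPoint_eq_add (h : IsAperiodicFlow F C φ) (hM : IsInvariantSet φ M)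
    (hκ : |κ| = 1) (hp : p ∈ M) {k : ℂ} (hk : k ∈ intLattice) {t t' s s' : ℝ}
    (hs : 0 < s) (hs' : 0 < s') (hsw : s ≤ stripWidth C) (hsw' : s' ≤ stripWidth C)
    (hgap : IsGap F κ M (φ p t) s) (hgap' : IsGap F κ M (φ p t') s')
    (he : normalPoint F κ (φ p t) s + k = normalPoint F κ (φ p t') s') :
    t = t' ∧ s = s' ∧ k = 0 := by
  rw [← h.normalPoint_add hk] at he
  obtain ⟨h1, h2⟩ := h.flow.eq_of_normalPoint_eq h.tame hκ hM.apply_mem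
    (hM.add_mem _ (hM.apply_mem p hp t) k hk) (hM.apply_mem p hp t') hs hs' hsw hsw'
    (h.isGap_add hM hk hgap) hgap' he
  have key : t = t' := by
    rcases lt_trichotomy t t' with hlt | heq | hlt
    · exact absurd (by rw [← h.flow.add h.tame, add_sub_cancel, ← h1])
        (h.apply_ne (φ p t) k hk (t' - t) (sub_pos.2 hlt))
    · exact heq
    · exact absurd (by rw [← h.flow.add h.tame, add_sub_cancel, ← h1]; ring)
        (h.apply_ne (φ p t') (-k) (neg_mem hk) (t - t') (sub_pos.2 hlt))
  subst key
  exact ⟨rfl, h2, by simpa using h1⟩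

/-- The gaps along an orbit in an invariant set have bounded total area. -/
theorem volume_le_gapArea (h : IsAperiodicFlow F C φ) (hM : IsInvariantSet φ M)
    (hκ : |κ| = 1) (hp : p ∈ M) {D : Set (ℝ × ℝ)} (hD : MeasurableSet D)
    (hgap : ∀ x ∈ D, 0 < x.2 ∧ x.2 ≤ stripWidth C ∧ IsGap F κ M (φ p x.1) x.2) :
    volume D ≤ ENNReal.ofReal (gapArea C) := by
  have hF := h.tame
  have hC := hF.pos
  set D' : Set ℂ := Complex.measurableEquivRealProd ⁻¹' D with hD'
  have hDm : MeasurableSet D' := Complex.measurableEquivRealProd.measurable hD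
  have hvol : volume D' = volume D :=
    Complex.volume_preserving_equiv_real_prod.measure_preimage hD.nullMeasurableSet
  rw [← hvol]
  have hgap' : ∀ x ∈ D', 0 < x.im ∧ x.im ≤ stripWidth C ∧ IsGap F κ M (φ p x.re) x.im :=
    fun x hx ↦ hgap _ hx
  set Ψ : ℂ → ℂ := fun x ↦ normalPoint F κ (φ p x.re) x.im with hΨ
  set Ψ' : ℂ → ℂ →L[ℝ] ℂ := fun x ↦ reCLM.smulRight (F (φ p x.re) + x.im *
    (normalUnit κ * fderiv ℝ F (φ p x.re) (F (φ p x.re)))) +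
      imCLM.smulRight (normalUnit κ * F (φ p x.re)) with hΨ'
  have hder : ∀ x, HasFDerivAt Ψ (Ψ' x) x := fun x ↦ by
    have h1 : HasFDerivAt (fun x : ℂ ↦ φ p x.re) (reCLM.smulRight (F (φ p x.re))) x := by
      have := (h.flow.isIntegralCurve p x.re).hasFDerivAt.comp x reCLM.hasFDerivAt
      exact this.congr_fderiv (by ext y; simp)
    have h2 := ((hF.contDiff.differentiable (by norm_num) (φ p x.re)).hasFDerivAt).comp x h1
    have h3 : HasFDerivAt (fun x : ℂ ↦ (x.im : ℂ)) (ofRealCLM.comp imCLM) x :=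
      (ofRealCLM.comp imCLM).hasFDerivAt
    have h4 := h1.add (h3.mul (h2.const_mul (normalUnit κ)))
    refine h4.congr_fderiv ?_
    refine ContinuousLinearMap.ext fun y ↦ ?_
    have e := (fderiv ℝ F (φ p x.re)).map_smul y.re (F (φ p x.re))
    simp only [real_smul] at e
    simp [hΨ']
    rw [e]
    ring
  have hinj : ∀ k ∈ intLattice, ∀ x ∈ D', ∀ y ∈ D', Ψ x + k = Ψ y → x = y ∧ k = 0 := by
    intro k hk x hx y hy hxy
    obtain ⟨h1, h2, h3⟩ := hgap' x hx
    obtain ⟨h4, h5, h6⟩ := hgap' y hy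
    obtain ⟨h7, h8, h9⟩ := h.eq_of_normalPoint_eq_add hM hκ hp hk h1 h4 h2 h5 h3 h6 hxy
    exact ⟨Complex.ext h7 h8, h9⟩
  have hinjOn : InjOn Ψ D' := fun x hx y hy hxy ↦
    (hinj 0 (zero_mem _) x hx y hy (by simpa using hxy)).1
  have himage := lintegral_abs_det_fderiv_eq_addHaar_image volume hDm
    (fun x _ ↦ (hder x).hasFDerivWithinAt) hinjOn
  have himm : MeasurableSet (Ψ '' D') :=
    measurable_image_of_fderivWithin hDm (fun x _ ↦ (hder x).hasFDerivWithinAt) hinjOn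
  have hle : volume (Ψ '' D') ≤ volume (ZSpan.fundamentalDomain Complex.basisOneI) := by
    by_contra! hlt
    have : Countable intLattice :=
      inferInstanceAs (Countable (Submodule.span ℤ (range Complex.basisOneI)))
    obtain ⟨a, b, hab, hdis⟩ := exists_pair_mem_lattice_not_disjoint_vadd
      (ZSpan.isAddFundamentalDomain' Complex.basisOneI volume) himm.nullMeasurableSet hlt
    obtain ⟨z, hza, hzb⟩ := Set.not_disjoint_iff.1 hdis
    obtain ⟨_, ⟨x, hx, rfl⟩, hxz⟩ := hza
    obtain ⟨_, ⟨y, hy, rfl⟩, hyz⟩ := hzb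
    have e : (a : ℂ) + Ψ x = b + Ψ y := hxz.trans hyz.symm
    have := (hinj (a - b) (sub_mem a.2 b.2) x hx y hy (by linear_combination e)).2
    exact hab (Subtype.ext (sub_eq_zero.1 this))
  have hdet : ∀ x ∈ D', ENNReal.ofReal (1 / (2 * C ^ 2)) ≤ ENNReal.ofReal |(Ψ' x).det| := by
    intro x hx
    obtain ⟨h1, h2, -⟩ := hgap' x hx
    have h3 : C * |x.im| ≤ 1 / 16 := hF.mul_abs_le (by rwa [abs_of_pos h1])
    set f := F (φ p x.re) with hf
    have hf0 : f ≠ 0 := hF.ne_zero (φ p x.re)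
    set q := frameRate F κ (φ p x.re) with hq
    have e1 : f + x.im * (normalUnit κ * fderiv ℝ F (φ p x.re) f) = f * (1 + x.im * q) := by
      rw [hq, frameRate, ← hf]
      field_simp
    have e2 : (Ψ' x).det = κ * (normSq f * (1 + x.im * q.re)) := by
      simp only [hΨ', det_re_smul_add_im_smul, ← hf, e1, normSq_apply]
      simp [normalUnit]
      ring
    have h4 := (abs_le.1 ((hF.abs_mul_re_frameRate hκ (φ p x.re) x.im).trans h3)).1
    have h5 : 1 / C ^ 2 ≤ normSq f := by
      rw [normSq_eq_norm_sq, div_le_iff₀ (by positivity), ← mul_pow]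
      have := hF.le_norm (φ p x.re)
      rw [mul_comm]
      exact one_le_pow₀ this
    refine ENNReal.ofReal_le_ofReal ?_
    rw [e2, abs_mul, hκ, one_mul, abs_of_nonneg (mul_nonneg (normSq_nonneg _) (by linarith))]
    have h6 : 1 / (2 * C ^ 2) = 1 / C ^ 2 * (1 / 2) := by ring
    rw [h6]
    exact mul_le_mul h5 (by linarith) (by norm_num) (normSq_nonneg _)
  have hmul : ENNReal.ofReal (1 / (2 * C ^ 2)) * volume D' ≤
      volume (ZSpan.fundamentalDomain Complex.basisOneI) := by
    refine le_trans ?_ hle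
    rw [← himage, ← setLIntegral_const]
    exact setLIntegral_mono' hDm hdet
  rw [ofReal_gapArea hC]
  calc volume D' = ENNReal.ofReal (2 * C ^ 2) * (ENNReal.ofReal (1 / (2 * C ^ 2)) * volume D') := by
        rw [← mul_assoc, ← ENNReal.ofReal_mul (by positivity), mul_one_div_cancel (by positivity),
          ENNReal.ofReal_one, one_mul]
    _ ≤ _ := by gcongr

end IsAperiodicFlow

end GapArea

section GapCurves

open Set Metric Complex MeasureTheory Filter Topology
open scoped NNReal ENNReal

variable {F : ℂ → ℂ} {C κ : ℝ} {φ : ℂ → ℝ → ℂ} {p : ℂ} {M : Set ℂ}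

namespace IsAperiodicFlow

theorem exists_forall_not_isGap (h : IsAperiodicFlow F C φ) (hM : IsInvariantSet φ M)
    (hκ : |κ| = 1) (hp : p ∈ M) {e : ℝ} (he : 0 < e) (hew : e ≤ stripWidth C) :
    ∃ T, 0 ≤ T ∧ ∀ t, T ≤ t → ¬ IsGap F κ M (φ p t) e := by
  by_contra! hcon
  have hcon' : ∀ T, ∃ t, T ≤ t ∧ IsGap F κ M (φ p t) e := fun T ↦ by
    obtain ⟨t, h1, h2⟩ := hcon (max T 0) (le_max_right _ _)
    exact ⟨t, (le_max_left _ _).trans h1, h2⟩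
  choose f hf hfg using hcon'
  have hC := h.tame.pos
  let u : ℕ → ℝ := fun n ↦ Nat.rec (f 0) (fun _ a ↦ f (a + 1)) n
  have hu : ∀ n, u n + 1 ≤ u (n + 1) := fun n ↦ hf _
  have hug : ∀ n, IsGap F κ M (φ p (u n)) e := fun n ↦ by
    cases n with
    | zero => exact hfg _
    | succ n => exact hfg _
  have hmono : Monotone u := monotone_nat_of_le_succ fun n ↦ by linarith [hu n]
  set e' := e * Real.exp (-(4 * C)) with he'
  have he'0 : 0 < e' := by positivity
  have he'e : e' ≤ e := mul_le_of_le_one_right he.le (Real.exp_le_one_iff.2 (by linarith))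
  set D : ℕ → Set (ℝ × ℝ) := fun n ↦ Ico (u n) (u n + 1) ×ˢ Ioc 0 e' with hD
  have hDm : ∀ n, MeasurableSet (D n) := fun n ↦ measurableSet_Ico.prod measurableSet_Ioc
  have hdisj : Pairwise (Function.onFun Disjoint D) := by
    have key : ∀ m n, m < n → Disjoint (D m) (D n) := fun m n hmn ↦ by
      rw [Set.disjoint_left]
      rintro ⟨a, b⟩ ⟨ha, -⟩ ⟨hb, -⟩
      have h1 := hu m
      have h2 := hmono (Nat.succ_le_of_lt hmn)
      have h3 := ha.2
      have h4 := hb.1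
      simp only [Nat.succ_eq_add_one] at h2 h3 h4
      linarith
    intro m n hmn
    rcases lt_or_gt_of_ne hmn with hlt | hlt
    · exact key m n hlt
    · exact (key n m hlt).symm
  have hle := h.volume_le_gapArea hM hκ hp (MeasurableSet.iUnion hDm) (by
    rintro ⟨t, s⟩ hx
    obtain ⟨n, hn⟩ := mem_iUnion.1 hx
    obtain ⟨⟨h1, h2⟩, h3, h4⟩ := hn
    simp only at h1 h2 h3 h4 ⊢
    refine ⟨h3, h4.trans (he'e.trans hew), ?_⟩
    have := h.flow.isGap_mul_exp h.tame hκ hM.apply_mem he hew (hug n) (τ := t - u n) (by linarith)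
    rw [← h.flow.add h.tame, add_sub_cancel] at this
    refine this.mono (h4.trans ?_)
    rw [he']
    refine mul_le_mul_of_nonneg_left (Real.exp_le_exp.2 ?_) he.le
    nlinarith)
  have hvol : ∀ n, volume (D n) = ENNReal.ofReal e' := fun n ↦ by
    simp [hD, Measure.volume_eq_prod, Measure.prod_prod]
  rw [measure_iUnion hdisj hDm] at hle
  simp only [hvol] at hle
  rw [ENNReal.tsum_const_eq_top_of_ne_zero (by simpa using he'0)] at hle
  exact absurd hle (not_le.2 ENNReal.ofReal_lt_top)

variable {w : ℝ → ℝ}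

theorem integral_le_gapArea (h : IsAperiodicFlow F C φ) (hM : IsInvariantSet φ M)
    (hκ : |κ| = 1) (hp : p ∈ M) (hw : Continuous w) (hpos : ∀ t, 0 < w t)
    (hlt : ∀ t, 0 ≤ t → w t < stripWidth C) (hgap : ∀ t, 0 ≤ t → IsGap F κ M (φ p t) (w t))
    {T : ℝ} (hT : 0 ≤ T) : ∫ t in (0 : ℝ)..T, w t ≤ gapArea C := by
  have hD : MeasurableSet (regionBetween (fun _ ↦ 0) w (Ioc 0 T)) :=
    measurableSet_regionBetween measurable_const hw.measurable measurableSet_Ioc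
  have hle := h.volume_le_gapArea hM hκ hp hD (by
    rintro ⟨t, s⟩ ⟨h1, h2⟩
    have ht : 0 ≤ t := h1.1.le
    have hsw : s ≤ w t := h2.2.le
    exact ⟨h2.1, hsw.trans (hlt t ht).le, (hgap t ht).mono hsw⟩)
  rw [Measure.volume_eq_prod, volume_regionBetween_eq_integral (by simp)
    ((hw.integrableOn_Icc).mono_set Ioc_subset_Icc_self) measurableSet_Ioc
    (fun t _ ↦ (hpos t).le)] at hle
  have hC0 : 0 ≤ gapArea C := by
    have := h.tame.pos
    rw [gapArea]
    positivity
  rw [ENNReal.ofReal_le_ofReal_iff hC0] at hle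
  rw [intervalIntegral.integral_of_le hT]
  simpa using hle

theorem exists_forall_lt_of_isGap (h : IsAperiodicFlow F C φ) (hM : IsInvariantSet φ M)
    (hκ : |κ| = 1) (hp : p ∈ M) (hgap : ∀ t, 0 ≤ t → IsGap F κ M (φ p t) (w t)) {e : ℝ}
    (he : 0 < e) : ∃ T, 0 ≤ T ∧ ∀ t, T ≤ t → w t < e := by
  obtain ⟨T, hT, hT'⟩ := h.exists_forall_not_isGap hM hκ hp
    (lt_min he (stripWidth_pos h.tame.one_le)) (min_le_right _ _)
  refine ⟨T, hT, fun t ht ↦ ?_⟩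
  by_contra! hle
  exact hT' t ht ((hgap t (hT.trans ht)).mono ((min_le_left _ _).trans hle))

/-- Along a curve bounding a gap, the gap stays in the strip if no gap has full width. -/
theorem lt_stripWidth_of_forall_not_isGap (h : IsAperiodicFlow F C φ) (hM : IsInvariantSet φ M)
    (hκ : |κ| = 1) (hw : IsIntegralCurve w (normalField F κ C (φ p)))
    (hgap : IsGap F κ M p (w 0)) (hno : ∀ t, 0 ≤ t → ¬ IsGap F κ M (φ p t) (stripWidth C))
    {t : ℝ} (ht : 0 ≤ t) : w t < stripWidth C := by
  by_contra! hle
  have hgap0 : IsGap F κ M (φ p 0) (w 0) := by rwa [h.flow.zero]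
  have h0 : w 0 < stripWidth C := by
    by_contra! h1
    exact hno 0 le_rfl (hgap0.mono h1)
  set S : Set ℝ := {r | 0 ≤ r ∧ stripWidth C ≤ w r} with hS
  have hSc : IsClosed S := isClosed_Ici.inter (isClosed_le continuous_const hw.continuous)
  have hSb : BddBelow S := ⟨0, fun r hr ↦ hr.1⟩
  have hmem : sInf S ∈ S := hSc.csInf_mem ⟨t, ht, hle⟩ hSb
  set b := sInf S with hb
  have hlt : ∀ r ∈ Ico 0 b, w r < stripWidth C := fun r hr ↦ by
    by_contra! h1
    exact absurd (csInf_le hSb (show r ∈ S from ⟨hr.1, h1⟩)) (not_le.2 hr.2)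
  have hb0 : 0 < b := lt_of_le_of_ne hmem.1 fun he ↦ by
    have := hmem.2
    rw [← he] at this
    linarith
  have hle' : ∀ r ∈ Icc 0 b, w r ≤ stripWidth C := by
    have hcl : closure (Ico 0 b) = Icc 0 b := closure_Ico hb0.ne
    rw [← hcl]
    exact closure_minimal (fun r hr ↦ (hlt r hr).le) (isClosed_le hw.continuous continuous_const)
  exact hno b hmem.1 ((h.flow.isGap_of_normalCurve h.tame hκ hM.apply_mem hw hmem.1 hle'
    hgap0).mono hmem.2)

/-- An invariant set with a gap admits a curve bounding gaps for all positive times. -/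
theorem exists_gapCurve (h : IsAperiodicFlow F C φ) (hM : IsInvariantSet φ M)
    (hκ : |κ| = 1) (hp : p ∈ M) {l : ℝ} (hl : 0 < l) (hgap : IsGap F κ M p l) :
    ∃ q ∈ M, ∃ w : ℝ → ℝ, IsIntegralCurve w (normalField F κ C (φ q)) ∧ (∀ t, 0 < w t) ∧
      (∀ t, 0 ≤ t → w t < stripWidth C) ∧ ∀ t, 0 ≤ t → IsGap F κ M (φ q t) (w t) := by
  have hε := stripWidth_pos h.tame.one_le
  obtain ⟨T, hT, hno⟩ := h.exists_forall_not_isGap hM hκ hp hε le_rfl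
  have hg := h.flow.isGap_mul_exp h.tame hκ hM.apply_mem (lt_min hl hε) (min_le_right _ _)
    (hgap.mono (min_le_left _ _)) hT
  set q := φ p T
  obtain ⟨w, hw0, hw⟩ := h.tame.exists_normalCurve hκ (h.flow.continuous q) 0
    (min l (stripWidth C) * Real.exp (-(4 * C * T)))
  have hpos := h.tame.normalCurve_pos hκ hw (t₀ := 0) (by
    rw [hw0]
    exact mul_pos (lt_min hl hε) (Real.exp_pos _))
  rw [← hw0] at hg
  have hlt : ∀ t, 0 ≤ t → w t < stripWidth C := fun t ht ↦
    h.lt_stripWidth_of_forall_not_isGap hM hκ hw hg (fun t ht ↦ by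
      rw [← h.flow.add h.tame]
      exact hno _ (by linarith)) ht
  refine ⟨q, hM.apply_mem p hp T, w, hw, hpos, hlt, fun t ht ↦ ?_⟩
  refine h.flow.isGap_of_normalCurve h.tame hκ hM.apply_mem hw ht (fun r hr ↦ (hlt r hr.1).le) ?_
  rwa [h.flow.zero]

end IsAperiodicFlow

/-- Denjoy's distortion estimate: solutions starting close to `0` stay below a summable one. -/
theorem IsTameField.abs_le_of_integral_le (hF : IsTameField F C) (hκ : |κ| = 1) {v : ℝ → ℂ}
    {w σ : ℝ → ℝ} {A : ℝ} (hw : IsIntegralCurve w (normalField F κ C v)) (hpos : ∀ t, 0 < w t)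
    (hlt : ∀ t, 0 ≤ t → w t < stripWidth C) (hA : ∀ T, 0 ≤ T → ∫ t in (0 : ℝ)..T, w t ≤ A)
    (hσ : IsIntegralCurve σ (normalField F κ C v))
    (h0 : |σ 0| ≤ w 0 * Real.exp (-(12 * C ^ 2 * A))) {t : ℝ} (ht : 0 ≤ t) : |σ t| ≤ w t := by
  have hC := hF.pos
  set E := Real.exp (-(12 * C ^ 2 * A)) with hE
  have hwc := hw.continuous
  set W : ℝ → ℝ := fun t ↦ ∫ u in (0 : ℝ)..t, w u with hW
  have hWd : ∀ t, HasDerivAt W (w t) t := fun t ↦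
    intervalIntegral.integral_hasDerivAt_right (hwc.intervalIntegrable _ _)
      hwc.aestronglyMeasurable.stronglyMeasurableAtFilter hwc.continuousAt
  set G : ℝ → ℝ := fun t ↦ E * Real.exp (12 * C ^ 2 * W t) with hG
  have hG0 : ∀ t, 0 < G t := fun t ↦ by positivity
  have hG1 : ∀ t, 0 ≤ t → G t ≤ 1 := fun t ht ↦ by
    simp only [hG, hE]
    rw [← Real.exp_add]
    refine Real.exp_le_one_iff.2 ?_
    have := mul_le_mul_of_nonneg_left (hA t ht) (show 0 ≤ 12 * C ^ 2 by positivity)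
    simp only [hW]
    linarith
  have hGd : ∀ t, HasDerivAt G (12 * C ^ 2 * w t * G t) t := fun t ↦ by
    refine (((hWd t).const_mul (12 * C ^ 2)).exp.const_mul E).congr_deriv ?_
    simp only [hG]
    ring
  set B : ℝ → ℝ := fun t ↦ w t * G t with hB
  have hBd : ∀ t, HasDerivAt B (normalField F κ C v t (w t) * G t +
      w t * (12 * C ^ 2 * w t * G t)) t := fun t ↦ (hw t).mul (hGd t)
  have hBw : ∀ t, 0 ≤ t → B t ≤ w t := fun t ht ↦ mul_le_of_le_one_right (hpos t).le (hG1 t ht)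
  have hB0 : ∀ t, 0 < B t := fun t ↦ mul_pos (hpos t) (hG0 t)
  have hB00 : B 0 = w 0 * E := by simp [hB, hG, hW]
  have key : ∀ ς : ℝ, |ς| = 1 → ∀ x ∈ Icc 0 t, ς * σ x ≤ B x := by
    intro ς hς
    have hς2 : ς * ς = 1 := by rw [← abs_mul_abs_self, hς, one_mul]
    refine image_le_of_deriv_right_lt_deriv_boundary'
      (f' := fun x ↦ ς * normalField F κ C v x (σ x))
      (B' := fun x ↦ normalField F κ C v x (w x) * G x + w x * (12 * C ^ 2 * w x * G x))
      (hσ.continuous.const_mul ς).continuousOn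
      (fun x _ ↦ ((hσ x).const_mul ς).hasDerivWithinAt) ?_
      (fun x _ ↦ (hBd x).continuousAt.continuousWithinAt) (fun x _ ↦ (hBd x).hasDerivWithinAt) ?_
    · rw [hB00]
      refine le_trans ?_ h0
      calc ς * σ 0 ≤ |ς * σ 0| := le_abs_self _
        _ = |σ 0| := by rw [abs_mul, hς, one_mul]
    · intro x hx hxB
      have hwx := hlt x hx.1
      have hw' : |w x| ≤ stripWidth C := by rw [abs_of_pos (hpos x)]; exact hwx.le
      have hσB : |σ x| = B x := by
        rw [← abs_of_pos (hB0 x), ← hxB, abs_mul, hς, one_mul]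
      have hσ' : |σ x| ≤ stripWidth C := by rw [hσB]; exact (hBw x hx.1).trans hwx.le
      have h1 := hF.abs_normalRate_sub_lin hκ (v x) (hF.mul_abs_le hw')
      have h2 := hF.abs_normalRate_sub_lin hκ (v x) (hF.mul_abs_le hσ')
      simp only [normalField, clamp_of_abs_le hw', clamp_of_abs_le hσ']
      set n := normalRateLin F κ (v x)
      have h3 : ς * normalRate F κ (v x) (σ x) ≤ n * B x + 4 * C ^ 2 * B x ^ 2 := by
        have h4 : |ς * (normalRate F κ (v x) (σ x) - n * σ x)| ≤ 4 * C ^ 2 * B x ^ 2 := by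
          rw [abs_mul, hς, one_mul, ← hσB, sq_abs]
          exact h2
        have h5 := (abs_le.1 h4).2
        rw [← hxB] at h5 ⊢
        linarith
      have h6 := mul_le_mul_of_nonneg_right (abs_le.1 h1).1 (hG0 x).le
      have h7 : B x ^ 2 ≤ w x * B x := by
        rw [sq]
        exact mul_le_mul_of_nonneg_right (hBw x hx.1) (hB0 x).le
      have h8 : 0 < C ^ 2 * (w x * B x) := mul_pos (by positivity) (mul_pos (hpos x) (hB0 x))
      have h9 : C ^ 2 * B x ^ 2 ≤ C ^ 2 * (w x * B x) := mul_le_mul_of_nonneg_left h7 (by positivity)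
      have h10 : B x = w x * G x := rfl
      have h11 : n * B x = n * (w x * G x) := by rw [h10]
      have h12 : C ^ 2 * (w x * B x) = C ^ 2 * (w x * (w x * G x)) := by rw [h10]
      nlinarith
  have h1 := key 1 (by simp) t (right_mem_Icc.2 ht)
  have h2 := key (-1) (by simp) t (right_mem_Icc.2 ht)
  have h3 := hBw t ht
  exact abs_le.2 ⟨by linarith, by linarith⟩

end GapCurves

section ReturnMap

open Set Metric Complex Filter Topology
open scoped NNReal ENNReal

variable {F : ℂ → ℂ} {C κ : ℝ} {φ : ℂ → ℝ → ℂ} {p : ℂ}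

theorem IsFlowOf.continuous_uncurry (hφ : IsFlowOf F φ) (hF : IsTameField F C) :
    Continuous (fun x : ℂ × ℝ ↦ φ x.1 x.2) := by
  have hC := hF.pos
  refine continuous_iff_continuousAt.2 fun x ↦ ?_
  have hlim : Tendsto (fun y : ℂ × ℝ ↦ C * |y.2 - x.2| + ‖y.1 - x.1‖ * Real.exp (C * |x.2|))
      (𝓝 x) (𝓝 0) := by
    have : Continuous
        (fun y : ℂ × ℝ ↦ C * |y.2 - x.2| + ‖y.1 - x.1‖ * Real.exp (C * |x.2|)) := by fun_prop
    simpa using this.tendsto x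
  refine tendsto_iff_dist_tendsto_zero.2 (squeeze_zero (fun _ ↦ dist_nonneg) (fun y ↦ ?_) hlim)
  rw [dist_eq_norm]
  calc ‖φ y.1 y.2 - φ x.1 x.2‖
      = ‖(φ y.1 y.2 - φ y.1 x.2) + (φ y.1 x.2 - φ x.1 x.2)‖ := by rw [sub_add_sub_cancel]
    _ ≤ ‖φ y.1 y.2 - φ y.1 x.2‖ + ‖φ y.1 x.2 - φ x.1 x.2‖ := norm_add_le _ _
    _ ≤ _ := add_le_add (hφ.norm_apply_sub_le hF _ _ _) (hφ.norm_sub_le hF _ _ _)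

/-- A first return to the normal line at `p` of a small normal segment has a fixed point. -/
theorem IsFlowOf.exists_fixedPoint (hφ : IsFlowOf F φ) (hF : IsTameField F C) (hκ : |κ| = 1)
    {δ r : ℝ} (hδ : 0 ≤ δ) (hrC : r ≤ 1 / (8 * C ^ 4)) (hrδ : 3 * C ^ 3 * r ≤ δ)
    {y : ℝ → ℂ} (hy : Continuous y) (hyr : ∀ s, |s| ≤ δ → ‖y s - p‖ ≤ r) :
    ∃ s τ, |s| ≤ δ ∧ |τ| ≤ 1 ∧ φ (y s) τ = normalPoint F κ p s := by
  have hC := hF.pos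
  have hC1 := hF.one_le
  have hex : ∀ s, |s| ≤ δ → ∃ τ, |τ| ≤ 1 / (4 * C ^ 3) ∧
      |τ| ≤ 2 * |((y s - p) / F p).re| ∧ ((φ (y s) τ - p) / F p).re = 0 := fun s hs ↦
    hφ.exists_re_eq_zero hF ((hyr s hs).trans hrC)
  choose! τ hτ1 hτ2 hτ0 using hex
  have hdiv : ∀ z : ℂ, ‖z / F p‖ ≤ C * ‖z‖ := fun z ↦ by
    rw [norm_div, div_le_iff₀ (hF.norm_pos p)]
    calc ‖z‖ ≤ ‖z‖ * (C * ‖F p‖) := le_mul_of_one_le_right (norm_nonneg _) (hF.le_norm p)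
      _ = _ := by ring
  have hτc : ContinuousOn τ (Icc (-δ) δ) := by
    intro s hs
    have hlim : Tendsto (fun s' ↦ 2 * (C * (‖y s' - y s‖ * Real.exp C))) (𝓝[Icc (-δ) δ] s)
        (𝓝 0) := by
      have : Continuous (fun s' ↦ 2 * (C * (‖y s' - y s‖ * Real.exp C))) := by fun_prop
      simpa using (this.tendsto s).mono_left nhdsWithin_le_nhds
    refine tendsto_iff_dist_tendsto_zero.2 (squeeze_zero' (Eventually.of_forall fun _ ↦ dist_nonneg)
      ?_ hlim)
    filter_upwards [self_mem_nhdsWithin] with s' hs'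
    have h1 := abs_le.2 hs
    have h2 := abs_le.2 hs'
    exact hφ.abs_crossing_sub_le hF ((hyr s' h2).trans hrC) (hτ1 s' h2) (hτ1 s h1) (hτ0 s' h2)
      (hτ0 s h1)
  set g : ℝ → ℝ := fun s ↦ κ * ((φ (y s) (τ s) - p) / F p).im with hg
  have hgc : ContinuousOn g (Icc (-δ) δ) := by
    have h1 : ContinuousOn (fun s ↦ φ (y s) (τ s)) (Icc (-δ) δ) :=
      (hφ.continuous_uncurry hF).comp_continuousOn (hy.continuousOn.prodMk hτc)
    exact continuousOn_const.mul
      (continuous_im.comp_continuousOn ((h1.sub continuousOn_const).div_const _))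
  have hgm : MapsTo g (Icc (-δ) δ) (Icc (-δ) δ) := by
    intro s hs
    have h1 := abs_le.2 hs
    have hr := hyr s h1
    have hr0 : 0 ≤ r := (norm_nonneg _).trans hr
    refine abs_le.1 ?_
    simp only [hg]
    rw [abs_mul, hκ, one_mul]
    have h2 : |τ s| ≤ 2 * (C * r) := (hτ2 s h1).trans (by
      gcongr
      exact (abs_re_le_norm _).trans ((hdiv _).trans (by gcongr)))
    have h3 : ‖φ (y s) (τ s) - p‖ ≤ C * (2 * (C * r)) + r := by
      rw [← sub_add_sub_cancel _ (y s)]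
      refine (norm_add_le _ _).trans (add_le_add ?_ hr)
      exact (hφ.norm_apply_sub_self_le hF _ _).trans (by gcongr)
    have h4 : 1 ≤ C ^ 2 := one_le_pow₀ hC1
    calc |((φ (y s) (τ s) - p) / F p).im| ≤ C * ‖φ (y s) (τ s) - p‖ :=
          (abs_im_le_norm _).trans (hdiv _)
      _ ≤ C * (C * (2 * (C * r)) + C ^ 2 * r) := by
          gcongr
          exact h3.trans (by gcongr; exact le_mul_of_one_le_left hr0 h4)
      _ = 3 * C ^ 3 * r := by ring
      _ ≤ δ := hrδ
  obtain ⟨s, hs, hfix⟩ := exists_mem_Icc_isFixedPt_of_mapsTo hgc (by linarith) hgm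
  have hs' := abs_le.2 hs
  refine ⟨s, τ s, hs', (hτ1 s hs').trans ?_, ?_⟩
  · have : 1 ≤ C ^ 3 := one_le_pow₀ hC1
    rw [div_le_one (by positivity)]
    linarith
  · have h1 := eq_normalPoint_of_re_eq_zero hF hκ (hτ0 s hs')
    rw [h1]
    congr 1

theorem IsAperiodicFlow.false_of_gapCurve {M : Set ℂ} {w : ℝ → ℝ} (h : IsAperiodicFlow F C φ)
    (hM : IsInvariantSet φ M)
    (hκ : |κ| = 1) (hp : p ∈ M) (hw : IsIntegralCurve w (normalField F κ C (φ p)))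
    (hpos : ∀ t, 0 < w t) (hlt : ∀ t, 0 ≤ t → w t < stripWidth C)
    (hgap : ∀ t, 0 ≤ t → IsGap F κ M (φ p t) (w t))
    (hrec : ∀ T r : ℝ, 0 < r → ∃ t, T ≤ t ∧ ∃ k ∈ intLattice, ‖φ p t + k - p‖ < r) : False := by
  have hF := h.tame
  have hC := hF.pos
  set δ := w 0 * Real.exp (-(12 * C ^ 2 * gapArea C)) with hδ
  have hδ0 : 0 < δ := mul_pos (hpos 0) (Real.exp_pos _)
  obtain ⟨r, hr0, hrC, hrδ⟩ : ∃ r, 0 < r ∧ (1 + C) * r ≤ 1 / (8 * C ^ 4) ∧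
      3 * C ^ 3 * ((1 + C) * r) ≤ δ := by
    have ha : 0 < 1 / (8 * C ^ 4) := by positivity
    have hb : 0 < δ / (3 * C ^ 3) := by positivity
    have hc : 0 < 1 + C := by linarith
    refine ⟨min (1 / (8 * C ^ 4)) (δ / (3 * C ^ 3)) / (1 + C), div_pos (lt_min ha hb) hc, ?_, ?_⟩
    · rw [mul_div_cancel₀ _ hc.ne']
      exact min_le_left _ _
    · rw [mul_div_cancel₀ _ hc.ne', mul_comm, ← le_div_iff₀ (by positivity)]
      exact min_le_right _ _
  obtain ⟨T, hT, hwT⟩ := h.exists_forall_lt_of_isGap hM hκ hp hgap hr0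
  obtain ⟨b, hb, k, hk, hbk⟩ := hrec (max T 4) r hr0
  have hb4 : 4 ≤ b := (le_max_right _ _).trans hb
  have hwb := hwT b ((le_max_left _ _).trans hb)
  have hb0 : 0 ≤ b := by linarith
  choose σ hσ0 hσ using hF.exists_normalCurve hκ (h.flow.continuous p) 0
  have hσw : ∀ s, |s| ≤ δ → ∀ t, 0 ≤ t → |σ s t| ≤ w t := fun s hs t ht ↦
    hF.abs_le_of_integral_le hκ hw hpos hlt
      (fun T hT ↦ h.integral_le_gapArea hM hκ hp hw.continuous hpos hlt hgap hT) (hσ s)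
      (by rwa [hσ0]) ht
  set y : ℝ → ℂ := fun s ↦ normalPoint F κ (φ p b) (σ s b) + k with hy
  have hσc : Continuous (fun s ↦ σ s b) := by
    have : LipschitzWith (Real.exp ((4 * C).toNNReal * b)).toNNReal (fun s ↦ σ s b) :=
      LipschitzWith.of_dist_le_mul fun s s' ↦ by
        have := (hσ s).dist_le_of_lipschitz (hF.lipschitzWith_normalField hκ _) (hσ s') hb0
        rwa [hσ0, hσ0, mul_comm, ← Real.coe_toNNReal (Real.exp _) (Real.exp_pos _).le] at this
    exact this.continuous
  have hyc : Continuous y := by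
    simp only [hy, normalPoint]
    fun_prop
  have hyr : ∀ s, |s| ≤ δ → ‖y s - p‖ ≤ (1 + C) * r := fun s hs ↦ by
    have e : y s - p = (φ p b + k - p) + σ s b * (normalUnit κ * F (φ p b)) := by
      simp only [hy, normalPoint]
      ring
    rw [e]
    refine (norm_add_le _ _).trans ?_
    rw [norm_mul, norm_mul, norm_normalUnit hκ, one_mul, Complex.norm_real, Real.norm_eq_abs]
    have h1 := (hσw s hs b hb0).trans hwb.le
    have h2 : |σ s b| * ‖F (φ p b)‖ ≤ r * C :=
      mul_le_mul h1 (hF.norm_le _) (norm_nonneg _) hr0.le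
    linarith
  obtain ⟨s, τ, hs, hτ, hfix⟩ := h.flow.exists_fixedPoint hF hκ hδ0.le hrC hrδ hyc hyr
  obtain ⟨θ, hθ, hθe⟩ := h.flow.exists_normalPoint_eq hF hκ (hσ s) hb0
    (fun t ht ↦ (hσw s hs t ht.1).trans (hlt t ht.1).le)
  rw [h.flow.zero, hσ0] at hθe
  have hτ' := (abs_le.1 hτ).1
  refine h.apply_ne (normalPoint F κ p s) (-k) (neg_mem hk) (θ + τ) (by linarith) ?_
  simp only [hy] at hfix
  rw [hθe, h.apply_add hk, ← h.flow.add hF] at hfix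
  linear_combination hfix

end ReturnMap

section MinimalSets

open Set Metric Complex Filter Topology
open scoped NNReal ENNReal

variable {F : ℂ → ℂ} {C κ : ℝ} {φ : ℂ → ℝ → ℂ} {p : ℂ}

/-- Nonempty closed sets invariant under the lattice and the forward flow. -/
structure IsForwardSet (φ : ℂ → ℝ → ℂ) (M : Set ℂ) : Prop where
  isClosed : IsClosed M
  nonempty : M.Nonempty
  add_mem : ∀ z ∈ M, ∀ k ∈ intLattice, z + k ∈ M
  apply_mem : ∀ z ∈ M, ∀ t, 0 ≤ t → φ z t ∈ M

/-- The closure of the lattice translates of the orbit of `z` after time `T`. -/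
def orbitHull (φ : ℂ → ℝ → ℂ) (z : ℂ) (T : ℝ) : Set ℂ :=
  closure {x | ∃ t, T ≤ t ∧ ∃ k ∈ intLattice, x = φ z t + k}

theorem exists_add_mem_fundamentalDomain (z : ℂ) :
    ∃ k ∈ intLattice, z + k ∈ ZSpan.fundamentalDomain Complex.basisOneI := by
  obtain ⟨v, hv, -⟩ := ZSpan.exist_unique_vadd_mem_fundamentalDomain Complex.basisOneI z
  exact ⟨v, v.2, by rw [add_comm]; exact hv⟩

theorem IsAperiodicFlow.isForwardSet_orbitHull (h : IsAperiodicFlow F C φ) (z : ℂ) (T : ℝ) :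
    IsForwardSet φ (orbitHull φ z T) where
  isClosed := isClosed_closure
  nonempty := ⟨φ z T, subset_closure ⟨T, le_rfl, 0, zero_mem _, by simp⟩⟩
  add_mem x hx k hk := by
    refine map_mem_closure (f := fun y ↦ y + k) (by fun_prop) hx ?_
    rintro _ ⟨t, ht, k', hk', rfl⟩
    exact ⟨t, ht, k' + k, add_mem hk' hk, by simp [add_assoc]⟩
  apply_mem x hx s hs := by
    refine map_mem_closure (f := fun y ↦ φ y s) (h.flow.continuous_left h.tame s) hx ?_
    rintro _ ⟨t, ht, k, hk, rfl⟩
    exact ⟨t + s, by linarith, k, hk, by beta_reduce; rw [h.apply_add hk, ← h.flow.add h.tame]⟩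

theorem exists_minimal_isForwardSet {S : Set ℂ} (hS : IsForwardSet φ S) :
    ∃ M, M ⊆ S ∧ Minimal (IsForwardSet φ) M := by
  refine zorn_superset_nonempty {M | IsForwardSet φ M} (fun c hc hchain hne ↦ ?_) S hS
  refine ⟨⋂₀ c, ⟨isClosed_sInter fun M hM ↦ (hc hM).isClosed, ?_, fun z hz k hk M hM ↦
    (hc hM).add_mem z (hz M hM) k hk, fun z hz t ht M hM ↦ (hc hM).apply_mem z (hz M hM) t ht⟩,
    fun M hM ↦ sInter_subset_of_mem hM⟩
  set Q := closure (ZSpan.fundamentalDomain Complex.basisOneI) with hQ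
  have hQc : IsCompact Q := (ZSpan.fundamentalDomain_isBounded _).isCompact_closure
  have : Nonempty c := hne.to_subtype
  have hnon : (⋂ M : c, (M : Set ℂ) ∩ Q).Nonempty := by
    refine IsCompact.nonempty_iInter_of_directed_nonempty_isCompact_isClosed _ ?_ ?_ ?_ ?_
    · intro A B
      rcases hchain.total A.2 B.2 with hAB | hAB
      · exact ⟨A, subset_rfl, inter_subset_inter_left _ hAB⟩
      · exact ⟨B, inter_subset_inter_left _ hAB, subset_rfl⟩
    · intro A
      obtain ⟨z, hz⟩ := (hc A.2).nonempty
      obtain ⟨k, hk, hzk⟩ := exists_add_mem_fundamentalDomain z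
      exact ⟨z + k, (hc A.2).add_mem z hz k hk, subset_closure hzk⟩
    · exact fun A ↦ hQc.inter_left (hc A.2).isClosed
    · exact fun A ↦ (hc A.2).isClosed.inter isClosed_closure
  obtain ⟨z, hz⟩ := hnon
  exact ⟨z, fun M hM ↦ (mem_iInter.1 hz ⟨M, hM⟩).1⟩

namespace IsAperiodicFlow

variable {M : Set ℂ}

theorem isInvariantSet_of_minimal (h : IsAperiodicFlow F C φ) (hM : Minimal (IsForwardSet φ) M) :
    IsInvariantSet φ M := by
  have hb : ∀ t, 0 ≤ t → ∀ z ∈ M, φ z (-t) ∈ M := fun t ht ↦ by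
    refine hM.le_of_le (y := {z | φ z (-t) ∈ M})
      ⟨hM.prop.isClosed.preimage (h.flow.continuous_left h.tame _), ?_, fun z hz k hk ↦ ?_,
        fun z hz s hs ↦ ?_⟩ fun z hz ↦ ?_
    · obtain ⟨z, hz⟩ := hM.prop.nonempty
      exact ⟨φ z t, by rwa [mem_ofPred_eq, h.flow.neg_apply h.tame]⟩
    · rw [mem_ofPred_eq, h.apply_add hk]
      exact hM.prop.add_mem _ hz k hk
    · rw [mem_ofPred_eq, ← h.flow.add h.tame, add_comm, h.flow.add h.tame]
      exact hM.prop.apply_mem _ hz s hs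
    · have := hM.prop.apply_mem _ hz t ht
      rwa [h.flow.apply_neg h.tame] at this
  refine ⟨hM.prop.isClosed, hM.prop.add_mem, fun z hz t ↦ ?_⟩
  rcases le_total 0 t with ht | ht
  · exact hM.prop.apply_mem z hz t ht
  · simpa using hb (-t) (by linarith) z hz

theorem recurrent_of_minimal (h : IsAperiodicFlow F C φ) (hM : Minimal (IsForwardSet φ) M)
    (hp : p ∈ M) (T r : ℝ) (hr : 0 < r) : ∃ t, T ≤ t ∧ ∃ k ∈ intLattice, ‖φ p t + k - p‖ < r := by
  have hinv := h.isInvariantSet_of_minimal hM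
  have hsub : orbitHull φ p T ⊆ M := by
    refine closure_minimal ?_ hinv.isClosed
    rintro _ ⟨t, -, k, hk, rfl⟩
    exact hinv.add_mem _ (hinv.apply_mem p hp t) k hk
  have hmem : p ∈ orbitHull φ p T := hM.le_of_le (h.isForwardSet_orbitHull p T) hsub hp
  obtain ⟨_, ⟨t, ht, k, hk, rfl⟩, hd⟩ := Metric.mem_closure_iff.1 hmem r hr
  exact ⟨t, ht, k, hk, by rwa [dist_comm, dist_eq_norm] at hd⟩

theorem exists_isGap (h : IsAperiodicFlow F C φ) (hM : IsInvariantSet φ M) (hne : M.Nonempty)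
    (huniv : M ≠ univ) : ∃ κ : ℝ, |κ| = 1 ∧ ∃ p ∈ M, ∃ l, 0 < l ∧ IsGap F κ M p l := by
  obtain ⟨z, hz⟩ := (ne_univ_iff_exists_notMem M).1 huniv
  obtain ⟨p, hp, hzp⟩ := hM.isClosed.exists_infDist_eq_dist hne z
  have hmin : ∀ q ∈ M, ‖p - z‖ ≤ ‖q - z‖ := fun q hq ↦ by
    have := infDist_le_dist_of_mem (x := z) hq
    rwa [hzp, dist_comm, dist_comm z, dist_eq_norm, dist_eq_norm] at this
  have hF0 := h.tame.ne_zero p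
  have hder : HasDerivAt (fun t ↦ ‖φ p t - z‖ ^ 2) (2 * inner ℝ (φ p 0 - z) (F (φ p 0))) 0 :=
    ((h.flow.isIntegralCurve p 0).sub_const z).norm_sq
  have hzero := IsLocalMin.hasDerivAt_eq_zero (f := fun t ↦ ‖φ p t - z‖ ^ 2) (a := 0)
    (Eventually.of_forall fun t ↦ by
      simp only [h.flow.zero]
      exact pow_le_pow_left₀ (norm_nonneg _) (hmin _ (hM.apply_mem p hp t)) 2) hder
  rw [h.flow.zero, Complex.inner] at hzero
  have hre : ((z - p) / F p).re = 0 := by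
    rw [div_re]
    simp at hzero ⊢
    rw [← add_div, div_eq_zero_iff]
    left
    linarith
  have hne0 : ((z - p) / F p).im ≠ 0 := fun him ↦ by
    have h1 : (z - p) / F p = 0 := Complex.ext hre him
    rw [div_eq_zero_iff, or_iff_left hF0, sub_eq_zero] at h1
    exact hz (h1 ▸ hp)
  obtain ⟨κ, hκ, hl⟩ : ∃ κ : ℝ, |κ| = 1 ∧ 0 < κ * ((z - p) / F p).im := by
    rcases lt_or_gt_of_ne hne0 with hlt | hlt
    · exact ⟨-1, by simp, by linarith⟩
    · exact ⟨1, by simp, by linarith⟩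
  refine ⟨κ, hκ, p, hp, κ * ((z - p) / F p).im, hl, fun r hr0 hrl hmem ↦ ?_⟩
  have hpt := eq_normalPoint_of_re_eq_zero h.tame hκ hre
  set l := κ * ((z - p) / F p).im
  have h1 := hmin _ hmem
  have e1 : p - z = (-l : ℝ) * (normalUnit κ * F p) := by
    rw [hpt, normalPoint]
    push_cast
    ring
  have e2 : normalPoint F κ p r - z = (r - l : ℝ) * (normalUnit κ * F p) := by
    conv_lhs => rw [hpt]
    simp only [normalPoint]
    push_cast
    ring
  rw [e1, e2] at h1
  simp only [norm_mul, norm_normalUnit hκ, one_mul, Complex.norm_real, Real.norm_eq_abs] at h1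
  have h2 := le_of_mul_le_mul_right h1 (h.tame.norm_pos p)
  rw [abs_neg, abs_of_pos hl, abs_of_nonpos (by linarith)] at h2
  linarith

/-- **Denjoy's theorem** in the universal cover: every orbit is dense modulo the lattice. -/
theorem orbitHull_eq_univ (h : IsAperiodicFlow F C φ) (z : ℂ) : orbitHull φ z 0 = univ := by
  by_contra hne
  obtain ⟨M, hMS, hM⟩ := exists_minimal_isForwardSet (h.isForwardSet_orbitHull z 0)
  have hinv := h.isInvariantSet_of_minimal hM
  obtain ⟨κ, hκ, p, hp, l, hl, hgap⟩ := h.exists_isGap hinv hM.prop.nonempty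
    fun e ↦ hne (univ_subset_iff.1 (e ▸ hMS))
  obtain ⟨q, hq, w, hw, hpos, hlt, hg⟩ := h.exists_gapCurve hinv hκ hp hl hgap
  exact h.false_of_gapCurve hinv hκ hq hw hpos hlt hg (h.recurrent_of_minimal hM hq)

end IsAperiodicFlow

end MinimalSets

section TorusCover

open Set Metric Complex Filter Topology

/-- The universal covering map `ℂ → Circle × Circle`. -/
noncomputable def torusCover (z : ℂ) : Circle × Circle :=
  (Circle.exp (2 * Real.pi * z.re), Circle.exp (2 * Real.pi * z.im))

theorem contMDiff_torusCover {n : WithTop ℕ∞} :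
    ContMDiff 𝓘(ℝ, ℂ) ((𝓡 1).prod (𝓡 1)) n torusCover := by
  have h1 : ContDiff ℝ n fun z : ℂ ↦ 2 * Real.pi * z.re :=
    contDiff_const.mul reCLM.contDiff
  have h2 : ContDiff ℝ n fun z : ℂ ↦ 2 * Real.pi * z.im :=
    contDiff_const.mul imCLM.contDiff
  exact (contMDiff_circleExp.comp h1.contMDiff).prodMk (contMDiff_circleExp.comp h2.contMDiff)

theorem continuous_torusCover : Continuous torusCover :=
  (contMDiff_torusCover (n := 0)).continuous

theorem surjective_torusCover : Function.Surjective torusCover := by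
  rintro ⟨a, b⟩
  obtain ⟨s, rfl⟩ := Circle.exp_surjective a
  obtain ⟨t, rfl⟩ := Circle.exp_surjective b
  refine ⟨⟨s / (2 * Real.pi), t / (2 * Real.pi)⟩, ?_⟩
  have := Real.pi_pos.ne'
  simp only [torusCover]
  congr 2 <;> field_simp

theorem exists_int_of_mem_intLattice {k : ℂ} (hk : k ∈ intLattice) :
    (∃ m : ℤ, k.re = m) ∧ ∃ n : ℤ, k.im = n := by
  have h := (Complex.basisOneI.mem_span_iff_repr_mem ℤ k).1 hk
  have h0 := h 0
  have h1 := h 1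
  simp only [coe_basisOneI_repr] at h0 h1
  obtain ⟨m, hm⟩ := h0
  obtain ⟨n, hn⟩ := h1
  exact ⟨⟨m, by simpa using hm.symm⟩, ⟨n, by simpa using hn.symm⟩⟩

theorem torusCover_add {k : ℂ} (hk : k ∈ intLattice) (z : ℂ) :
    torusCover (z + k) = torusCover z := by
  obtain ⟨⟨m, hm⟩, ⟨n, hn⟩⟩ := exists_int_of_mem_intLattice hk
  simp [torusCover, hm, hn, mul_add, Circle.exp_add, Circle.exp_two_pi_mul_int]

theorem eq_zero_of_hasFDerivAt_exp {L : ℂ →L[ℝ] ℝ} {z v : ℂ} {D : ℂ →L[ℝ] ℂ}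
    (h : HasFDerivAt (fun z ↦ (Circle.exp (2 * Real.pi * L z) : ℂ)) D z) (hD : D v = 0) :
    L v = 0 := by
  have h1 : HasFDerivAt (fun z ↦ ((2 * Real.pi * L z : ℝ) : ℂ))
      (ofRealCLM.comp ((2 * Real.pi) • L)) z :=
    ofRealCLM.hasFDerivAt.comp z (L.hasFDerivAt.const_mul (2 * Real.pi))
  have h2 := (h1.mul_const I).cexp
  have h3 := (h.unique h2) ▸ hD
  simpa [Real.pi_pos.ne'] using h3

theorem isInvertible_mfderiv_torusCover (z : ℂ) :
    (mfderiv 𝓘(ℝ, ℂ) ((𝓡 1).prod (𝓡 1)) torusCover z).IsInvertible := by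
  have hd := (contMDiff_torusCover (n := 1)).mdifferentiable one_ne_zero z
  have hc : ContMDiff (𝓡 1) 𝓘(ℝ, ℂ) 1 (fun x : Circle ↦ (x : ℂ)) :=
    haveI : Fact (Module.finrank ℝ ℂ = 1 + 1) := finrank_real_complex_fact'
    contMDiff_coe_sphere
  have hg1 : ContMDiff ((𝓡 1).prod (𝓡 1)) 𝓘(ℝ, ℂ) 1 fun x : Circle × Circle ↦ (x.1 : ℂ) :=
    hc.comp contMDiff_fst
  have hg2 : ContMDiff ((𝓡 1).prod (𝓡 1)) 𝓘(ℝ, ℂ) 1 fun x : Circle × Circle ↦ (x.2 : ℂ) :=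
    hc.comp contMDiff_snd
  have c1 := ((hg1.mdifferentiable one_ne_zero (torusCover z)).hasMFDerivAt.comp z
    hd.hasMFDerivAt).hasFDerivAt
  have c2 := ((hg2.mdifferentiable one_ne_zero (torusCover z)).hasMFDerivAt.comp z
    hd.hasMFDerivAt).hasFDerivAt
  have hzero : ∀ (A : EuclideanSpace ℝ (Fin 1) × EuclideanSpace ℝ (Fin 1) →L[ℝ] ℂ)
      (D : ℂ →L[ℝ] EuclideanSpace ℝ (Fin 1) × EuclideanSpace ℝ (Fin 1)) (v : ℂ),
      D v = 0 → (A.comp D) v = 0 := fun A D v h ↦ by simp [h]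
  have hinj : Function.Injective (mfderiv 𝓘(ℝ, ℂ) ((𝓡 1).prod (𝓡 1)) torusCover z) := by
    rw [injective_iff_map_eq_zero]
    intro v hv
    have r1 : reCLM v = 0 := eq_zero_of_hasFDerivAt_exp (z := z) (v := v) (L := reCLM) c1 (hzero _ _ _ hv)
    have r2 : imCLM v = 0 := eq_zero_of_hasFDerivAt_exp (z := z) (v := v) (L := imCLM) c2 (hzero _ _ _ hv)
    exact Complex.ext r1 r2
  have key : ∀ D : ℂ →L[ℝ] EuclideanSpace ℝ (Fin 1) × EuclideanSpace ℝ (Fin 1),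
      Function.Injective D → D.IsInvertible := fun D hD ↦ by
    let e := LinearEquiv.ofInjectiveOfFinrankEq 
      (D : ℂ →ₗ[ℝ] EuclideanSpace ℝ (Fin 1) × EuclideanSpace ℝ (Fin 1)) hD (by simp)
    exact ⟨e.toContinuousLinearEquiv, by ext1 x; rfl⟩
  exact key _ hinj

end TorusCover

section TameLift

open Set Metric Complex Filter Topology

theorem exists_norm_le_of_periodic {E : Type*} [NormedAddCommGroup E] {G : ℂ → E}
    (hG : Continuous G) (hper : ∀ k ∈ intLattice, ∀ z, G (z + k) = G z) :
    ∃ B, ∀ z, ‖G z‖ ≤ B := by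
  have hcomp : IsCompact (closure (ZSpan.fundamentalDomain Complex.basisOneI)) :=
    (ZSpan.fundamentalDomain_isBounded Complex.basisOneI).isCompact_closure
  obtain ⟨B, hB⟩ := hcomp.exists_bound_of_continuousOn hG.continuousOn
  refine ⟨B, fun z ↦ ?_⟩
  obtain ⟨k, hk, hz⟩ := exists_add_mem_fundamentalDomain z
  rw [← hper k hk z]
  exact hB _ (subset_closure hz)

theorem fderiv_add_of_periodic {E : Type*} [NormedAddCommGroup E] [NormedSpace ℝ E] {G : ℂ → E}
    {k : ℂ} (hper : ∀ z, G (z + k) = G z) (z : ℂ) : fderiv ℝ G (z + k) = fderiv ℝ G z := by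
  rw [← fderiv_comp_add_right]
  simp_rw [hper]

theorem exists_isTameField {F : ℂ → ℂ} (hF : ContDiff ℝ 2 F)
    (hper : ∀ k ∈ intLattice, ∀ z, F (z + k) = F z) (hne : ∀ z, F z ≠ 0) :
    ∃ C, IsTameField F C := by
  have hF1 : ContDiff ℝ 1 (fderiv ℝ F) := hF.fderiv_right (by norm_num)
  have hper1 : ∀ k ∈ intLattice, ∀ z, fderiv ℝ F (z + k) = fderiv ℝ F z :=
    fun k hk z ↦ fderiv_add_of_periodic (hper k hk) z
  obtain ⟨A, hA⟩ := exists_norm_le_of_periodic hF.continuous hper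
  obtain ⟨B, hB⟩ := exists_norm_le_of_periodic (G := fun z ↦ (F z)⁻¹)
    (hF.continuous.inv₀ hne) fun k hk z ↦ by rw [hper k hk z]
  obtain ⟨D, hD⟩ := exists_norm_le_of_periodic hF1.continuous hper1
  obtain ⟨L, hL⟩ := exists_norm_le_of_periodic (hF1.continuous_fderiv one_ne_zero)
    fun k hk z ↦ fderiv_add_of_periodic (hper1 k hk) z
  have hA0 := (norm_nonneg _).trans (hA 0)
  have hB0 := (norm_nonneg _).trans (hB 0)
  have hD0 := (norm_nonneg _).trans (hD 0)
  have hL0 := (norm_nonneg _).trans (hL 0)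
  have hdiff : Differentiable ℝ F := hF.differentiable two_ne_zero
  have hdiff1 : Differentiable ℝ (fderiv ℝ F) := hF1.differentiable one_ne_zero
  refine ⟨1 + A + B + D + L, by linarith, hF, fun z ↦ (hA z).trans (by linarith), fun z ↦ ?_,
    fun z w ↦ ?_, fun z ↦ (hD z).trans (by linarith), fun z u ↦ ?_⟩
  · have h := hB z
    rw [norm_inv, inv_le_iff_one_le_mul₀ (norm_pos_iff.2 (hne z))] at h
    refine h.trans ?_
    gcongr
    linarith
  · refine (convex_univ.norm_image_sub_le_of_norm_fderiv_le (fun x _ ↦ hdiff x)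
      (fun x _ ↦ hD x) (mem_univ w) (mem_univ z)).trans ?_
    gcongr
    linarith
  · have hlip : ∀ y, ‖fderiv ℝ F y - fderiv ℝ F z‖ ≤ L * ‖y - z‖ := fun y ↦
      convex_univ.norm_image_sub_le_of_norm_fderiv_le (fun x _ ↦ hdiff1 x)
        (fun x _ ↦ hL x) (mem_univ z) (mem_univ y)
    have h := (convex_segment z (z + u)).norm_image_sub_le_of_norm_hasFDerivWithin_le'
      (f := F) (φ := fderiv ℝ F z) (C := L * ‖u‖) (fun x _ ↦ (hdiff x).hasFDerivAt.hasFDerivWithinAt)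
      (fun x hx ↦ (hlip x).trans (by
        gcongr
        simpa using norm_sub_le_of_mem_segment hx))
      (left_mem_segment ℝ z (z + u)) (right_mem_segment ℝ z (z + u))
    rw [add_sub_cancel_left] at h
    refine h.trans ?_
    rw [mul_assoc, ← sq]
    gcongr
    linarith

variable {X : (x : Circle × Circle) → TangentSpace ((𝓡 1).prod (𝓡 1)) x}

/-- The lift of a vector field on the torus to the universal cover. -/
noncomputable def liftField (X : (x : Circle × Circle) → TangentSpace ((𝓡 1).prod (𝓡 1)) x) :
    ℂ → ℂ :=
  VectorField.mpullback 𝓘(ℝ, ℂ) ((𝓡 1).prod (𝓡 1)) torusCover X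

theorem mfderiv_torusCover_liftField (z : ℂ) :
    mfderiv 𝓘(ℝ, ℂ) ((𝓡 1).prod (𝓡 1)) torusCover z (liftField X z) = X (torusCover z) :=
  (isInvertible_mfderiv_torusCover z).self_apply_inverse _

theorem liftField_ne_zero (hX : ∀ x, X x ≠ 0) (z : ℂ) : liftField X z ≠ 0 := fun h ↦
  hX (torusCover z) ((mfderiv_torusCover_liftField z).symm.trans
    ((congrArg (mfderiv 𝓘(ℝ, ℂ) ((𝓡 1).prod (𝓡 1)) torusCover z) h).trans (map_zero _)))

theorem contDiff_liftField (hX : ContMDiff ((𝓡 1).prod (𝓡 1)) ((𝓡 1).prod (𝓡 1)).tangent 2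
      (fun x => (⟨x, X x⟩ : TangentBundle ((𝓡 1).prod (𝓡 1)) (Circle × Circle)))) :
    ContDiff ℝ 2 (liftField X) := by
  have h := hX.mpullback_vectorField (contMDiff_torusCover (n := 3))
    isInvertible_mfderiv_torusCover (by norm_num)
  rw [contDiff_iff_contDiffAt]
  exact fun z ↦ contMDiffAt_vectorSpace_iff_contDiffAt.1 (h z)

theorem liftField_add {k : ℂ} (hk : k ∈ intLattice) (z : ℂ) :
    liftField X (z + k) = liftField X z := by
  have hd : MDifferentiableAt 𝓘(ℝ, ℂ) ((𝓡 1).prod (𝓡 1)) torusCover (z + k) :=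
    (contMDiff_torusCover (n := 1)).mdifferentiable one_ne_zero _
  have ht : HasMFDerivAt 𝓘(ℝ, ℂ) 𝓘(ℝ, ℂ) (fun w : ℂ ↦ w + k) z (ContinuousLinearMap.id ℝ ℂ) :=
    ((hasFDerivAt_id z).add_const k).hasMFDerivAt
  have hcomp : torusCover ∘ (fun w ↦ w + k) = torusCover := funext fun w ↦ torusCover_add hk w
  have h := (hd.hasMFDerivAt.comp z ht).mfderiv
  rw [hcomp] at h
  apply (isInvertible_mfderiv_torusCover z).injective
  have hX : (X (torusCover (z + k)) : EuclideanSpace ℝ (Fin 1) × EuclideanSpace ℝ (Fin 1)) =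
      X (torusCover z) :=
    congrArg (fun x ↦ (X x : EuclideanSpace ℝ (Fin 1) × EuclideanSpace ℝ (Fin 1)))
      (torusCover_add hk z)
  exact (DFunLike.congr_fun h (liftField X (z + k))).trans
    ((mfderiv_torusCover_liftField (z + k)).trans (hX.trans (mfderiv_torusCover_liftField z).symm))

end TameLift

section Density

open Set Metric Complex Filter Topology

variable {X : (x : Circle × Circle) → TangentSpace ((𝓡 1).prod (𝓡 1)) x}
  {C : ℝ} {φ : ℂ → ℝ → ℂ}

theorem isMIntegralCurve_torusCover (hφ : IsFlowOf (liftField X) φ) (z : ℂ) :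
    IsMIntegralCurve (fun t ↦ torusCover (φ z t)) X := fun t ↦ by
  have hd : MDifferentiableAt 𝓘(ℝ, ℂ) ((𝓡 1).prod (𝓡 1)) torusCover (φ z t) :=
    (contMDiff_torusCover (n := 1)).mdifferentiable one_ne_zero _
  have h := hd.hasMFDerivAt.comp t (hφ.isIntegralCurve z t).hasFDerivAt.hasMFDerivAt
  refine h.congr_mfderiv ?_
  refine ContinuousLinearMap.ext_ring ?_
  have hone : (ContinuousLinearMap.toSpanSingleton ℝ (liftField X (φ z t))) 1 =
      liftField X (φ z t) := by simp
  have hone' : ((1 : ℝ →L[ℝ] ℝ).smulRight (X (torusCover (φ z t)))) (1 : ℝ) =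
      X (torusCover (φ z t)) := by simp
  exact (congrArg (mfderiv 𝓘(ℝ, ℂ) ((𝓡 1).prod (𝓡 1)) torusCover (φ z t)) hone).trans
    ((mfderiv_torusCover_liftField _).trans hone'.symm)

theorem not_constant_of_isMIntegralCurve (hX : ∀ x, X x ≠ 0) {γ : ℝ → Circle × Circle}
    (hγ : IsMIntegralCurve γ X) : ∃ s t, γ s ≠ γ t := by
  by_contra! hc
  have hconst : γ = fun _ ↦ γ 0 := funext fun t ↦ hc t 0
  have h1 := (hγ 0).mfderiv
  have h2 : mfderiv 𝓘(ℝ, ℝ) ((𝓡 1).prod (𝓡 1)) γ 0 = 0 := by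
    rw [hconst]
    exact mfderiv_const
  rw [h2] at h1
  apply hX (γ 0)
  have h3 := DFunLike.congr_fun h1 (1 : ℝ)
  have hone : ((1 : ℝ →L[ℝ] ℝ).smulRight (X (γ 0))) (1 : ℝ) = X (γ 0) := by simp
  exact hone.symm.trans (h3.symm.trans (zero_apply (1 : ℝ)))

theorem isAperiodicFlow_liftField (hF : IsTameField (liftField X) C)
    (hφ : IsFlowOf (liftField X) φ) (hX : ∀ x, X x ≠ 0)
    (haper : ¬ ∃ γ : ℝ → Circle × Circle, IsMIntegralCurve γ X ∧
        (∃ s t : ℝ, γ s ≠ γ t) ∧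
        (∃ T : ℝ, 0 < T ∧ ∀ t : ℝ, γ (t + T) = γ t)) :
    IsAperiodicFlow (liftField X) C φ where
  tame := hF
  flow := hφ
  map_add _ hk z := liftField_add hk z
  apply_ne z k hk T hT h := by
    have hγ := isMIntegralCurve_torusCover hφ z
    refine haper ⟨_, hγ, not_constant_of_isMIntegralCurve hX hγ, T, hT, fun t ↦ ?_⟩
    rw [add_comm t, hφ.add hF, h, hφ.apply_add_of_periodic hF (liftField_add hk),
      torusCover_add hk]

theorem IsAperiodicFlow.closure_range_torusCover {F : ℂ → ℂ} (h : IsAperiodicFlow F C φ) (z : ℂ) :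
    closure (range fun t ↦ torusCover (φ z t)) = univ := by
  refine eq_univ_of_forall fun x ↦ ?_
  obtain ⟨w, rfl⟩ := surjective_torusCover x
  have hw : w ∈ orbitHull φ z 0 := h.orbitHull_eq_univ z ▸ mem_univ w
  refine map_mem_closure continuous_torusCover hw ?_
  rintro _ ⟨t, -, k, hk, rfl⟩
  exact ⟨t, (torusCover_add hk _).symm⟩

end Density

/-- **Denjoy's theorem for flows on the 2-torus.** If a `C²` nonvanishing vector field
on the 2-torus `Circle × Circle` has no periodic orbit, then every integral curve of
the vector field has dense image. -/
theorem denjoy_flow_on_torus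
    (X : (x : Circle × Circle) → TangentSpace ((𝓡 1).prod (𝓡 1)) x)
    (hX : ContMDiff ((𝓡 1).prod (𝓡 1)) ((𝓡 1).prod (𝓡 1)).tangent 2
      (fun x => (⟨x, X x⟩ : TangentBundle ((𝓡 1).prod (𝓡 1)) (Circle × Circle))))
    (hX0 : ∀ x : Circle × Circle, X x ≠ 0)
    (haper : ¬ ∃ γ : ℝ → Circle × Circle, IsMIntegralCurve γ X ∧
        (∃ s t : ℝ, γ s ≠ γ t) ∧
        (∃ T : ℝ, 0 < T ∧ ∀ t : ℝ, γ (t + T) = γ t)) :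
    ∀ γ : ℝ → Circle × Circle, IsMIntegralCurve γ X →
      closure (Set.range γ) = Set.univ := by
  intro γ hγ
  obtain ⟨C, hF⟩ := exists_isTameField (contDiff_liftField hX) (fun _ hk z ↦ liftField_add hk z)
    (liftField_ne_zero hX0)
  obtain ⟨φ, hφ⟩ := hF.exists_isFlowOf
  obtain ⟨z, hz⟩ := surjective_torusCover (γ 0)
  have heq : γ = fun t ↦ torusCover (φ z t) :=
    isMIntegralCurve_Ioo_eq_of_contMDiff_boundaryless (t₀ := 0) (hX.of_le one_le_two) hγ
      (isMIntegralCurve_torusCover hφ z) (by rw [hφ.zero, hz])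
  rw [heq]
  exact (isAperiodicFlow_liftField hF hφ hX0 haper).closure_range_torusCover z
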